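/- For any bounded measurable function φ on X: (1) γ̂_n^N(φ) → γ̂_n(φ) almost surely, and N·var(γ̂_n^N(φ)/γ̂_n(1)) → Σ_{p=0}^n c_p^{−1} v̂_{p,n}(φ) = σ̂_n²(φ) as N → ∞; (2) η̂_n^N(φ) → η̂_n(φ) almost surely, and N·E[(η̂_n^N(φ) − η̂_n(φ))²] → σ̂_n²(φ − η̂_n(φ)) as N → ∞. -/

import Mathlib

open MeasureTheory ProbabilityTheory Filter
open scoped ENNReal NNReal Classical

noncomputable section

namespace PFVar

variable {X : Type*} [MeasurableSpace X]

/-- The unnormalized Feynman–Kac measures `γ_p`. -/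
def gammaFK (M0 : Measure X) (M : ℕ → Kernel X X) (G : ℕ → X → ℝ) : ℕ → Measure X
  | 0 => M0
  | p + 1 =>
      ((gammaFK M0 M G p).withDensity fun x => ENNReal.ofReal (G p x)).bind
        (fun x => M (p + 1) x)

/-- `γ_n(φ)`. -/
def gInt (M0 : Measure X) (M : ℕ → Kernel X X) (G : ℕ → X → ℝ) (n : ℕ) (φ : X → ℝ) : ℝ :=
  ∫ x, φ x ∂(gammaFK M0 M G n)

/-- `η_n(φ) = γ_n(φ)/γ_n(1)`. -/
def eInt (M0 : Measure X) (M : ℕ → Kernel X X) (G : ℕ → X → ℝ) (n : ℕ) (φ : X → ℝ) : ℝ :=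
  gInt M0 M G n φ / gInt M0 M G n 1

/-- Law of the path `(X_0,…,X_k)` of an inhomogeneous Markov chain with initial law `μ0` and
transitions `κ`, recorded as an element of `ℕ → Y` (coordinates beyond `k` are junk). -/
def markovPath {Y : Type*} [MeasurableSpace Y] (μ0 : Measure Y) (κ : ℕ → Y → Measure Y) :
    ℕ → Measure (ℕ → Y)
  | 0 => μ0.map fun y _ => y
  | k + 1 =>
      (markovPath μ0 κ k).bind fun ω =>
        (κ (k + 1) (ω k)).map fun y => Function.update ω (k + 1) y

/-- Categorical distribution on `{0,…,m−1} ⊆ ℕ` with weights `w`. -/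
def cat (m : ℕ) (w : ℕ → ℝ) : Measure ℕ :=
  (∑ j ∈ Finset.range m, ENNReal.ofReal (w j))⁻¹ •
    ∑ j ∈ Finset.range m, ENNReal.ofReal (w j) • Measure.dirac j

/-- Uniform distribution on `{0,…,m−1}`. -/
def unif (m : ℕ) : Measure ℕ := cat m fun _ => 1

/-- Extend a finite tuple to `ℕ` with junk values. -/
def padF {Y : Type*} [Nonempty Y] {m : ℕ} (f : Fin m → Y) : ℕ → Y := fun i =>
  if h : i < m then f ⟨i, h⟩ else Classical.arbitrary Y

/-- One resampling/mutation step of the particle filter: given the time-`p` configuration `z`,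
the joint law of the ancestor indices `A_p` and the time-`p+1` particle configuration;
each of the `Np (p+1)` new particles independently draws an ancestor from the categorical
distribution with weights `G p (z j)`, `j < Np p`, and then moves according to `M (p+1)`. -/
def pfStep [Nonempty X] (M : ℕ → Kernel X X) (G : ℕ → X → ℝ) (Np : ℕ → ℕ) (p : ℕ)
    (z : ℕ → X) : Measure ((ℕ → ℕ) × (ℕ → X)) :=
  (Measure.pi fun _ : Fin (Np (p + 1)) =>
      (cat (Np p) fun j => G p (z j)).bind fun a =>
        (M (p + 1) (z a)).map fun x => (a, x)).map fun f =>
    (padF fun i => (f i).1, padF fun i => (f i).2)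

/-- The law of the particle system `(ζ, A)` run up to time `k`: the first component is
`ζ : time → particle index → X`, the second is `A : time → particle index → ℕ`, where
`A p i` is the ancestor index of particle `i` of generation `p+1`. -/
def pfLaw [Nonempty X] (M0 : Measure X) (M : ℕ → Kernel X X) (G : ℕ → X → ℝ)
    (Np : ℕ → ℕ) : ℕ → Measure ((ℕ → ℕ → X) × (ℕ → ℕ → ℕ))
  | 0 =>
      (Measure.pi fun _ : Fin (Np 0) => M0).map fun f =>
        (fun p => if p = 0 then padF f else fun _ => Classical.arbitrary X, fun _ _ => 0)
  | k + 1 =>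
      (pfLaw M0 M G Np k).bind fun ω =>
        (pfStep M G Np k (ω.1 k)).map fun az =>
          (Function.update ω.1 (k + 1) az.2, Function.update ω.2 k az.1)

/-- Eve indices: `eve A 0 i = i` and `eve A (p+1) i = eve A p (A p i)`. -/
def eve (A : ℕ → ℕ → ℕ) : ℕ → ℕ → ℕ
  | 0 => fun i => i
  | p + 1 => fun i => eve A p (A p i)

/-- `η_n^N(φ)`. -/
def etaN (Np : ℕ → ℕ) (n : ℕ) (φ : X → ℝ) (ω : (ℕ → ℕ → X) × (ℕ → ℕ → ℕ)) : ℝ :=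
  (Np n : ℝ)⁻¹ * ∑ i ∈ Finset.range (Np n), φ (ω.1 n i)

/-- `γ_n^N(φ)`. -/
def gammaN (G : ℕ → X → ℝ) (Np : ℕ → ℕ) (n : ℕ) (φ : X → ℝ)
    (ω : (ℕ → ℕ → X) × (ℕ → ℕ → ℕ)) : ℝ :=
  (∏ p ∈ Finset.range n, etaN Np p (G p) ω) * etaN Np n φ ω

/-- The variance estimator `V_n^N(φ)`. -/
def Vest (Np : ℕ → ℕ) (n : ℕ) (φ : X → ℝ) (ω : (ℕ → ℕ → X) × (ℕ → ℕ → ℕ)) : ℝ :=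
  etaN Np n φ ω ^ 2 -
    (∏ p ∈ Finset.range n, (Np p : ℝ) / ((Np p : ℝ) - 1)) *
      ((Np n : ℝ) * ((Np n : ℝ) - 1))⁻¹ *
      ∑ i ∈ Finset.range (Np n), ∑ j ∈ Finset.range (Np n),
        if eve ω.2 n i ≠ eve ω.2 n j then φ (ω.1 n i) * φ (ω.1 n j) else 0

/-- Initial law of the doubled chain used to define `μ_b`. -/
def pairInit (M0 : Measure X) (b : ℕ → Bool) : Measure (X × X) :=
  if b 0 then M0.map fun x => (x, x) else M0.prod M0

/-- Transitions of the doubled chain used to define `μ_b`. -/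
def pairKer (M : ℕ → Kernel X X) (b : ℕ → Bool) (p : ℕ) (q : X × X) : Measure (X × X) :=
  if b p then (M p q.1).map fun y => (y, y) else (M p q.1).prod (M p q.2)

/-- `μ_b(φ) = E_b[φ(X_n, X_n') ∏_{p<n} G_p(X_p) G_p(X_p')]`. -/
def muB (M0 : Measure X) (M : ℕ → Kernel X X) (G : ℕ → X → ℝ) (n : ℕ) (b : ℕ → Bool)
    (φ : X × X → ℝ) : ℝ :=
  ∫ ω, φ (ω n) * ∏ p ∈ Finset.range n, G p (ω p).1 * G p (ω p).2
    ∂(markovPath (pairInit M0 b) (pairKer M b) n)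

/-- `φ ⊗ φ`. -/
def tens (φ : X → ℝ) : X × X → ℝ := fun q => φ q.1 * φ q.2

/-- The binary string `e_p`. -/
def eVec (p : ℕ) : ℕ → Bool := fun q => q == p

/-- The zero binary string `0_n`. -/
def zeroVec : ℕ → Bool := fun _ => false

/-- Extension of a finite binary string to `ℕ → Bool`. -/
def extB (n : ℕ) (b : Fin (n + 1) → Bool) : ℕ → Bool := fun p =>
  if h : p < n + 1 then b ⟨p, h⟩ else false

/-- `v_{p,n}(φ) = (μ_{e_p}(φ⊗φ) − μ_{0_n}(φ⊗φ)) / γ_n(1)²`. -/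
def vpn (M0 : Measure X) (M : ℕ → Kernel X X) (G : ℕ → X → ℝ) (n p : ℕ) (φ : X → ℝ) : ℝ :=
  (muB M0 M G n (eVec p) (tens φ) - muB M0 M G n zeroVec (tens φ)) / gInt M0 M G n 1 ^ 2

/-- `σ_n²(φ) = Σ_{p=0}^n c_p⁻¹ v_{p,n}(φ)`. -/
def sigma2 (M0 : Measure X) (M : ℕ → Kernel X X) (G : ℕ → X → ℝ) (c : ℕ → ℝ) (n : ℕ)
    (φ : X → ℝ) : ℝ :=
  ∑ p ∈ Finset.range (n + 1), (c p)⁻¹ * vpn M0 M G n p φ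

/-- Particle numbers `N_p = ⌈c_p N⌉`. -/
def npart (c : ℕ → ℝ) (N : ℕ) (p : ℕ) : ℕ := ⌈c p * (N : ℝ)⌉₊

/-- Backward tracing: `traceAux A n kn j = K_{n-j}` where `K_n = kn`, `K_p = A p (K_{p+1})`. -/
def traceAux (A : ℕ → ℕ → ℕ) (n kn : ℕ) : ℕ → ℕ
  | 0 => kn
  | j + 1 => A (n - (j + 1)) (traceAux A n kn j)

/-- The deterministic ancestral trace `K¹`: `trace A n kn p = K_p¹` given `K_n¹ = kn`. -/
def trace (A : ℕ → ℕ → ℕ) (n kn : ℕ) : ℕ → ℕ := fun p => traceAux A n kn (n - p)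

/-- Conditional law of the broken-lineage trace `(K_0²,…,K_p²)` given `K_p² = v`
(entries above `p` are junk, to be overwritten). -/
def k2Law (G : ℕ → X → ℝ) (Np : ℕ → ℕ) (ω : (ℕ → ℕ → X) × (ℕ → ℕ → ℕ)) (K1 : ℕ → ℕ) :
    ℕ → ℕ → Measure (ℕ → ℕ)
  | 0 => fun v => Measure.dirac fun q => if q = 0 then v else 0
  | p + 1 => fun v =>
      ((if v = K1 (p + 1) then cat (Np p) fun j => G p (ω.1 p j)
          else Measure.dirac (ω.2 p v)).bind fun w =>
        (k2Law G Np ω K1 p w).map fun f => Function.update f (p + 1) v)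

/-- Conditional law of `(K¹, K²)` given the particle system `ω = (ζ, A)`. -/
def kLaw (G : ℕ → X → ℝ) (Np : ℕ → ℕ) (n : ℕ) (ω : (ℕ → ℕ → X) × (ℕ → ℕ → ℕ)) :
    Measure ((ℕ → ℕ) × (ℕ → ℕ)) :=
  (unif (Np n)).bind fun k1n =>
    (unif (Np n)).bind fun k2n =>
      (k2Law G Np ω (trace ω.2 n k1n) n k2n).map fun k2 => (trace ω.2 n k1n, k2)

/-- Joint law of the particle system together with the tracing variables `(K¹, K²)`. -/
def pfkLaw [Nonempty X] (M0 : Measure X) (M : ℕ → Kernel X X) (G : ℕ → X → ℝ)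
    (Np : ℕ → ℕ) (n : ℕ) :
    Measure (((ℕ → ℕ → X) × (ℕ → ℕ → ℕ)) × ((ℕ → ℕ) × (ℕ → ℕ))) :=
  (pfLaw M0 M G Np n).bind fun ω => (kLaw G Np n ω).map fun k => (ω, k)

/-- `(k¹, k²) ∈ I(b)`. -/
def inI (Np : ℕ → ℕ) (n : ℕ) (b : ℕ → Bool) (k : (ℕ → ℕ) × (ℕ → ℕ)) : Prop :=
  ∀ p ≤ n, k.1 p < Np p ∧ k.2 p < Np p ∧ (k.1 p = k.2 p ↔ b p = true)

/-- The particle approximation `μ_b^N(φ)` (a function of the realization `ω = (ζ, A)`);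
the conditional expectation given `(A, ζ)` is the integral with respect to `kLaw`. -/
def muBN (G : ℕ → X → ℝ) (Np : ℕ → ℕ) (n : ℕ) (b : ℕ → Bool) (φ : X × X → ℝ)
    (ω : (ℕ → ℕ → X) × (ℕ → ℕ → ℕ)) : ℝ :=
  (∏ p ∈ Finset.range (n + 1),
      if b p then (Np p : ℝ) else (Np p : ℝ) / ((Np p : ℝ) - 1)) *
    gammaN G Np n 1 ω ^ 2 *
    ∫ k, (if inI Np n b k then (1 : ℝ) else 0) * φ (ω.1 n (k.1 n), ω.1 n (k.2 n))
      ∂(kLaw G Np n ω)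

/-- `v_{p,n}^N(φ)`. -/
def vpnN (G : ℕ → X → ℝ) (Np : ℕ → ℕ) (n p : ℕ) (φ : X → ℝ)
    (ω : (ℕ → ℕ → X) × (ℕ → ℕ → ℕ)) : ℝ :=
  (muBN G Np n (eVec p) (tens φ) ω - muBN G Np n zeroVec (tens φ) ω) / gammaN G Np n 1 ω ^ 2

/-- `v_n^N(φ) = Σ_{p=0}^n c_p⁻¹ v_{p,n}^N(φ)`. -/
def vnN (G : ℕ → X → ℝ) (Np : ℕ → ℕ) (c : ℕ → ℝ) (n : ℕ) (φ : X → ℝ)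
    (ω : (ℕ → ℕ → X) × (ℕ → ℕ → ℕ)) : ℝ :=
  ∑ p ∈ Finset.range (n + 1), (c p)⁻¹ * vpnN G Np n p φ ω

/-- `QAux M G n φ j = Q_{n-j,n}(φ)`. -/
def QAux (M : ℕ → Kernel X X) (G : ℕ → X → ℝ) (n : ℕ) (φ : X → ℝ) : ℕ → X → ℝ
  | 0 => φ
  | j + 1 => fun x => G (n - (j + 1)) x * ∫ y, QAux M G n φ j y ∂(M (n - j) x)

/-- `Q_{p,n}(φ)` where `Q_p(x, dx') = G_{p-1}(x) M_p(x, dx')`, `Q_{n,n} = Id`,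
`Q_{p,n} = Q_{p+1} ⋯ Q_n`. -/
def Qpn (M : ℕ → Kernel X X) (G : ℕ → X → ℝ) (n p : ℕ) (φ : X → ℝ) : X → ℝ :=
  QAux M G n φ (n - p)

/-- `φ̂ = G_n · φ`. -/
def hatf (G : ℕ → X → ℝ) (n : ℕ) (φ : X → ℝ) : X → ℝ := fun x => G n x * φ x

/-- `γ̂_n(φ) = γ_n(G_n φ)`. -/
def gHatInt (M0 : Measure X) (M : ℕ → Kernel X X) (G : ℕ → X → ℝ) (n : ℕ) (φ : X → ℝ) : ℝ :=
  gInt M0 M G n (hatf G n φ)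

/-- `η̂_n(φ) = γ̂_n(φ)/γ̂_n(1)`. -/
def eHatInt (M0 : Measure X) (M : ℕ → Kernel X X) (G : ℕ → X → ℝ) (n : ℕ) (φ : X → ℝ) : ℝ :=
  gHatInt M0 M G n φ / gHatInt M0 M G n 1

/-- `γ̂_n^N(φ) = γ_n^N(G_n φ)`. -/
def gammaHatN (G : ℕ → X → ℝ) (Np : ℕ → ℕ) (n : ℕ) (φ : X → ℝ)
    (ω : (ℕ → ℕ → X) × (ℕ → ℕ → ℕ)) : ℝ :=
  gammaN G Np n (hatf G n φ) ω

/-- `η̂_n^N(φ) = γ̂_n^N(φ)/γ̂_n^N(1)`. -/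
def etaHatN (G : ℕ → X → ℝ) (Np : ℕ → ℕ) (n : ℕ) (φ : X → ℝ)
    (ω : (ℕ → ℕ → X) × (ℕ → ℕ → ℕ)) : ℝ :=
  gammaHatN G Np n φ ω / gammaHatN G Np n 1 ω

/-- `v̂_{p,n}(φ) = v_{p,n}(φ̂)/η_n(G_n)²`. -/
def vpnHat (M0 : Measure X) (M : ℕ → Kernel X X) (G : ℕ → X → ℝ) (n p : ℕ) (φ : X → ℝ) : ℝ :=
  vpn M0 M G n p (hatf G n φ) / eInt M0 M G n (G n) ^ 2

/-- `σ̂_n²(φ) = Σ_{p=0}^n c_p⁻¹ v̂_{p,n}(φ)`. -/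
def sigma2Hat (M0 : Measure X) (M : ℕ → Kernel X X) (G : ℕ → X → ℝ) (c : ℕ → ℝ) (n : ℕ)
    (φ : X → ℝ) : ℝ :=
  ∑ p ∈ Finset.range (n + 1), (c p)⁻¹ * vpnHat M0 M G n p φ

/-- `V̂_n^N(φ) = V_n^N(φ̂)/η_n^N(G_n)²`. -/
def VestHat (G : ℕ → X → ℝ) (Np : ℕ → ℕ) (n : ℕ) (φ : X → ℝ)
    (ω : (ℕ → ℕ → X) × (ℕ → ℕ → ℕ)) : ℝ :=
  Vest Np n (hatf G n φ) ω / etaN Np n (G n) ω ^ 2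

/-- `v̂_{p,n}^N(φ) = v_{p,n}^N(φ̂)/η_n^N(G_n)²`. -/
def vpnHatN (G : ℕ → X → ℝ) (Np : ℕ → ℕ) (n p : ℕ) (φ : X → ℝ)
    (ω : (ℕ → ℕ → X) × (ℕ → ℕ → ℕ)) : ℝ :=
  vpnN G Np n p (hatf G n φ) ω / etaN Np n (G n) ω ^ 2

/-- `v̂_n^N(φ) = Σ_{p=0}^n c_p⁻¹ v̂_{p,n}^N(φ)`. -/
def vnHatN (G : ℕ → X → ℝ) (Np : ℕ → ℕ) (c : ℕ → ℝ) (n : ℕ) (φ : X → ℝ)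
    (ω : (ℕ → ℕ → X) × (ℕ → ℕ → ℕ)) : ℝ :=
  ∑ p ∈ Finset.range (n + 1), (c p)⁻¹ * vpnHatN G Np n p φ ω


open PFVar MeasureTheory ProbabilityTheory Filter

/-- Bounded measurable real functions. -/
def BddMeas {Y : Type*} [MeasurableSpace Y] (f : Y → ℝ) : Prop :=
  Measurable f ∧ ∃ C, ∀ y, |f y| ≤ C

section BddMeas

variable {Y Z : Type*} [MeasurableSpace Y] [MeasurableSpace Z] {f g : Y → ℝ}

lemma BddMeas.const (a : ℝ) : BddMeas fun _ : Y => a :=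
  ⟨measurable_const, |a|, fun _ => le_rfl⟩

lemma BddMeas.mul (hf : BddMeas f) (hg : BddMeas g) : BddMeas fun y => f y * g y := by
  obtain ⟨hf, C, hC⟩ := hf
  obtain ⟨hg, D, hD⟩ := hg
  refine ⟨hf.mul hg, C * D, fun y => ?_⟩
  rw [abs_mul]
  exact mul_le_mul (hC y) (hD y) (abs_nonneg _) ((abs_nonneg _).trans (hC y))

lemma BddMeas.add (hf : BddMeas f) (hg : BddMeas g) : BddMeas fun y => f y + g y := by
  obtain ⟨hf, C, hC⟩ := hf
  obtain ⟨hg, D, hD⟩ := hg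
  exact ⟨hf.add hg, C + D, fun y => (abs_add_le _ _).trans (add_le_add (hC y) (hD y))⟩

lemma BddMeas.sub (hf : BddMeas f) (hg : BddMeas g) : BddMeas fun y => f y - g y := by
  obtain ⟨hf, C, hC⟩ := hf
  obtain ⟨hg, D, hD⟩ := hg
  exact ⟨hf.sub hg, C + D, fun y => (abs_sub _ _).trans (add_le_add (hC y) (hD y))⟩

lemma BddMeas.pow (hf : BddMeas f) (k : ℕ) : BddMeas fun y => f y ^ k := by
  induction k with
  | zero => simpa using BddMeas.const (1 : ℝ)
  | succ k ih => simpa only [pow_succ] using ih.mul hf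

lemma BddMeas.comp (hf : BddMeas f) {T : Z → Y} (hT : Measurable T) :
    BddMeas fun z => f (T z) :=
  ⟨hf.1.comp hT, hf.2.imp fun _ h z => h (T z)⟩

lemma BddMeas.sum {ι : Type*} (s : Finset ι) {F : ι → Y → ℝ} (h : ∀ i ∈ s, BddMeas (F i)) :
    BddMeas fun y => ∑ i ∈ s, F i y := by
  induction s using Finset.induction_on with
  | empty => simpa using BddMeas.const (0 : ℝ)
  | insert a s ha ih =>
    simp only [Finset.sum_insert ha]
    exact (h a (by simp)).add (ih fun i hi => h i (by simp [hi]))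

lemma BddMeas.prod {ι : Type*} (s : Finset ι) {F : ι → Y → ℝ} (h : ∀ i ∈ s, BddMeas (F i)) :
    BddMeas fun y => ∏ i ∈ s, F i y := by
  induction s using Finset.induction_on with
  | empty => simpa using BddMeas.const (1 : ℝ)
  | insert a s ha ih =>
    simp only [Finset.prod_insert ha]
    exact (h a (by simp)).mul (ih fun i hi => h i (by simp [hi]))

lemma BddMeas.integrable (hf : BddMeas f) (μ : Measure Y) [IsFiniteMeasure μ] :
    Integrable f μ := by
  obtain ⟨hf, C, hC⟩ := hf
  exact Integrable.of_bound hf.aestronglyMeasurable C (.of_forall fun y => hC y)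

lemma BddMeas.integral_kernel (hf : BddMeas f) (κ : Kernel Z Y) [IsMarkovKernel κ] :
    BddMeas fun z => ∫ y, f y ∂κ z := by
  obtain ⟨hf, C, hC⟩ := hf
  refine ⟨(hf.stronglyMeasurable.integral_kernel (κ := κ)).measurable, C, fun z => ?_⟩
  simpa using norm_integral_le_of_norm_le_const (μ := κ z) (f := f) (.of_forall hC)

end BddMeas

section Bind

variable {α β γ : Type*} [MeasurableSpace α] [MeasurableSpace β] [MeasurableSpace γ]

lemma integral_bind_kernel (μ : Measure α) [IsFiniteMeasure μ] (κ : Kernel α β)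
    [IsMarkovKernel κ] {F : β → ℝ} (hF : BddMeas F) :
    ∫ b, F b ∂(μ.bind κ) = ∫ a, ∫ b, F b ∂κ a ∂μ := by
  have h := Kernel.integral_comp (η := κ) (κ := Kernel.const Unit μ) (a := ()) (f := F)
  rw [Kernel.comp_apply, Kernel.const_apply] at h
  exact h (hF.integrable _)

lemma measurable_map_of_uncurry (κ : Kernel α β) [IsSFiniteKernel κ] {T : α → β → γ}
    (hT : Measurable (Function.uncurry T)) : Measurable fun a => (κ a).map (T a) := by
  refine Measure.measurable_of_measurable_coe _ fun s hs => ?_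
  have h : (fun a => (κ a).map (T a) s)
      = fun a => κ a (Prod.mk a ⁻¹' (Function.uncurry T ⁻¹' s)) := by
    ext a
    exact Measure.map_apply (hT.comp measurable_prodMk_left) hs
  rw [h]
  exact Kernel.measurable_kernel_prodMk_left (hT hs)

/-- The kernel `a ↦ (κ a).map (T a)`. -/
def mapKernel (κ : Kernel α β) [IsSFiniteKernel κ] {T : α → β → γ}
    (hT : Measurable (Function.uncurry T)) : Kernel α γ :=
  ⟨fun a => (κ a).map (T a), measurable_map_of_uncurry κ hT⟩

instance (κ : Kernel α β) [IsMarkovKernel κ] {T : α → β → γ}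
    (hT : Measurable (Function.uncurry T)) : IsMarkovKernel (mapKernel κ hT) :=
  ⟨fun _ => Measure.isProbabilityMeasure_map (hT.comp measurable_prodMk_left).aemeasurable⟩

lemma isProbabilityMeasure_bind_map (μ : Measure α) [IsProbabilityMeasure μ] (κ : Kernel α β)
    [IsMarkovKernel κ] {T : α → β → γ} (hT : Measurable (Function.uncurry T)) :
    IsProbabilityMeasure (μ.bind fun a => (κ a).map (T a)) :=
  inferInstanceAs (IsProbabilityMeasure (μ.bind (mapKernel κ hT)))

lemma integral_bind_map (μ : Measure α) [IsFiniteMeasure μ] (κ : Kernel α β)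
    [IsMarkovKernel κ] {T : α → β → γ} (hT : Measurable (Function.uncurry T)) {F : γ → ℝ}
    (hF : BddMeas F) :
    ∫ c, F c ∂(μ.bind fun a => (κ a).map (T a)) = ∫ a, ∫ b, F (T a b) ∂κ a ∂μ := by
  refine (integral_bind_kernel μ (mapKernel κ hT) hF).trans
    (integral_congr_ae (.of_forall fun a => ?_))
  exact integral_map (hT.comp measurable_prodMk_left).aemeasurable hF.1.aestronglyMeasurable

end Bind

section Moments

variable {Y : Type*} [MeasurableSpace Y]

lemma centered_sum_moments {ι : Type*} [Fintype ι] (ν : Measure Y) [IsProbabilityMeasure ν]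
    {g : Y → ℝ} (hg : Measurable g) {B : ℝ} (hB : ∀ y, |g y| ≤ B) (h0 : ∫ y, g y ∂ν = 0)
    (s : Finset ι) :
    ∫ y, (∑ i ∈ s, g (y i)) ∂(Measure.pi fun _ : ι => ν) = 0 ∧
    ∫ y, (∑ i ∈ s, g (y i)) ^ 2 ∂(Measure.pi fun _ : ι => ν) = s.card * ∫ y, g y ^ 2 ∂ν ∧
    ∫ y, (∑ i ∈ s, g (y i)) ^ 4 ∂(Measure.pi fun _ : ι => ν) ≤ 3 * s.card ^ 2 * B ^ 4 := by
  set π := Measure.pi fun _ : ι => ν with hπ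
  have hgb : BddMeas g := ⟨hg, B, hB⟩
  have hB2 : ∀ y, g y ^ 2 ≤ B ^ 2 := fun y => by
    rw [← sq_abs]; exact pow_le_pow_left₀ (abs_nonneg _) (hB y) 2
  have hv0 : 0 ≤ ∫ y, g y ^ 2 ∂ν := integral_nonneg fun y => sq_nonneg _
  have hv : ∫ y, g y ^ 2 ∂ν ≤ B ^ 2 := by
    simpa using integral_mono ((hgb.pow 2).integrable ν) (integrable_const (B ^ 2)) hB2
  have hv4 : ∫ y, g y ^ 4 ∂ν ≤ B ^ 4 := by
    refine (integral_mono ((hgb.pow 4).integrable ν) (integrable_const (B ^ 4)) fun y => ?_).trans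
      (by simp)
    have := pow_le_pow_left₀ (sq_nonneg _) (hB2 y) 2
    simpa only [← pow_mul] using this
  have hind : iIndepFun (fun (i : ι) (y : ι → Y) => g (y i)) π :=
    iIndepFun_pi fun _ => hg.aemeasurable
  have heval : ∀ (i : ι) (k : ℕ), ∫ y, g (y i) ^ k ∂π = ∫ y, g y ^ k ∂ν := fun i k => by
    have hmp := measurePreserving_eval (fun _ : ι => ν) i
    rw [← hmp.map_eq, integral_map hmp.measurable.aemeasurable
      (hgb.pow k).1.aestronglyMeasurable]
  induction s using Finset.induction_on with
  | empty => simp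
  | insert a s ha ih =>
    obtain ⟨ih1, ih2, ih4⟩ := ih
    have hS : BddMeas fun y : ι → Y => ∑ i ∈ s, g (y i) :=
      BddMeas.sum s fun i _ => hgb.comp (measurable_pi_apply i)
    have hY : BddMeas fun y : ι → Y => g (y a) := hgb.comp (measurable_pi_apply a)
    have hSY : IndepFun (fun y : ι → Y => ∑ i ∈ s, g (y i)) (fun y => g (y a)) π := by
      have := hind.indepFun_finsetSum_of_notMem
        (fun i => hg.comp (measurable_pi_apply i)) ha
      convert! this using 1
      ext y
      simp [Finset.sum_apply]
    have hmul : ∀ k l : ℕ, ∫ y, (∑ i ∈ s, g (y i)) ^ k * g (y a) ^ l ∂π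
        = (∫ y, (∑ i ∈ s, g (y i)) ^ k ∂π) * ∫ y, g y ^ l ∂ν := fun k l => by
      rw [← heval a l]
      exact (hSY.comp (measurable_id.pow_const k)
        (measurable_id.pow_const l)).integral_mul_eq_mul_integral
        (hS.pow k).1.aestronglyMeasurable (hY.pow l).1.aestronglyMeasurable
    have hint : ∀ k l : ℕ, Integrable (fun y => (∑ i ∈ s, g (y i)) ^ k * g (y a) ^ l) π :=
      fun k l => ((hS.pow k).mul (hY.pow l)).integrable π
    simp only [Finset.sum_insert ha, Finset.card_insert_of_notMem ha]
    have h1 := hmul 1 0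
    have h01 := hmul 0 1
    have h11 := hmul 1 1
    have h20 := hmul 2 0
    have h02 := hmul 0 2
    have h40 := hmul 4 0
    have h31 := hmul 3 1
    have h22 := hmul 2 2
    have h13 := hmul 1 3
    have h04 := hmul 0 4
    simp only [pow_one, h0, ih1, mul_zero, zero_mul] at h1 h01 h11 h31 h13
    simp only [pow_zero, one_mul, mul_one, integral_const, probReal_univ, smul_eq_mul]
      at h1 h01 h20 h02 h40 h04
    refine ⟨?_, ?_, ?_⟩
    · have := integral_add (hint 0 1) (hint 1 0)
      simp only [pow_one, pow_zero, one_mul, mul_one] at this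
      rw [this, h01, ih1, add_zero]
    · have e : ∀ y : ι → Y, (g (y a) + ∑ i ∈ s, g (y i)) ^ 2
          = ((∑ i ∈ s, g (y i)) ^ 2 * g (y a) ^ 0 + (∑ i ∈ s, g (y i)) ^ 0 * g (y a) ^ 2)
            + 2 * ((∑ i ∈ s, g (y i)) ^ 1 * g (y a) ^ 1) := fun y => by ring
      simp only [e]
      have i1 : Integrable (fun y : ι → Y => (∑ i ∈ s, g (y i)) ^ 2 * g (y a) ^ 0
        + (∑ i ∈ s, g (y i)) ^ 0 * g (y a) ^ 2) π := (hint 2 0).add (hint 0 2)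
      rw [integral_add i1 ((hint 1 1).const_mul 2), integral_add (hint 2 0) (hint 0 2),
        integral_const_mul, hmul, hmul, hmul]
      simp only [pow_one, h0, ih2]
      push_cast
      simp
      ring
    · have e : ∀ y : ι → Y, (g (y a) + ∑ i ∈ s, g (y i)) ^ 4
          = ((((∑ i ∈ s, g (y i)) ^ 4 * g (y a) ^ 0 + (∑ i ∈ s, g (y i)) ^ 0 * g (y a) ^ 4)
            + 4 * ((∑ i ∈ s, g (y i)) ^ 3 * g (y a) ^ 1))
            + 4 * ((∑ i ∈ s, g (y i)) ^ 1 * g (y a) ^ 3))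
            + 6 * ((∑ i ∈ s, g (y i)) ^ 2 * g (y a) ^ 2) := fun y => by ring
      simp only [e]
      have i1 : Integrable (fun y : ι → Y => (∑ i ∈ s, g (y i)) ^ 4 * g (y a) ^ 0
        + (∑ i ∈ s, g (y i)) ^ 0 * g (y a) ^ 4) π := (hint 4 0).add (hint 0 4)
      have i2 : Integrable (fun y : ι → Y => ((∑ i ∈ s, g (y i)) ^ 4 * g (y a) ^ 0
        + (∑ i ∈ s, g (y i)) ^ 0 * g (y a) ^ 4)
        + 4 * ((∑ i ∈ s, g (y i)) ^ 3 * g (y a) ^ 1)) π := i1.add ((hint 3 1).const_mul 4)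
      have i3 : Integrable (fun y : ι → Y => (((∑ i ∈ s, g (y i)) ^ 4 * g (y a) ^ 0
        + (∑ i ∈ s, g (y i)) ^ 0 * g (y a) ^ 4)
        + 4 * ((∑ i ∈ s, g (y i)) ^ 3 * g (y a) ^ 1))
        + 4 * ((∑ i ∈ s, g (y i)) ^ 1 * g (y a) ^ 3)) π := i2.add ((hint 1 3).const_mul 4)
      rw [integral_add i3 ((hint 2 2).const_mul 6), integral_add i2 ((hint 1 3).const_mul 4),
        integral_add i1 ((hint 3 1).const_mul 4), integral_add (hint 4 0) (hint 0 4)]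
      simp only [integral_const_mul, hmul]
      simp only [pow_one, h0, ih1, ih2, pow_zero, integral_const, probReal_univ, smul_eq_mul,
        mul_one, one_mul, mul_zero, zero_mul, add_zero]
      have hvv : (∫ y, g y ^ 2 ∂ν) * ∫ y, g y ^ 2 ∂ν ≤ B ^ 2 * B ^ 2 :=
        mul_le_mul hv hv hv0 (sq_nonneg _)
      have hc : (0 : ℝ) ≤ s.card := Nat.cast_nonneg _
      have := mul_le_mul_of_nonneg_left hvv hc
      have hB4 : 0 ≤ B ^ 4 := by positivity
      push_cast
      nlinarith

lemma sample_mean_moments (ν : Measure Y) [IsProbabilityMeasure ν] {g : Y → ℝ}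
    (hg : Measurable g) {B : ℝ} (hB : ∀ y, |g y| ≤ B) {m : ℕ} (hm : 0 < m) :
    ∫ y, ((m : ℝ)⁻¹ * ∑ i, g (y i) - ∫ y, g y ∂ν) ∂(Measure.pi fun _ : Fin m => ν) = 0 ∧
    ∫ y, ((m : ℝ)⁻¹ * ∑ i, g (y i) - ∫ y, g y ∂ν) ^ 2 ∂(Measure.pi fun _ : Fin m => ν)
      = (m : ℝ)⁻¹ * (∫ y, g y ^ 2 ∂ν - (∫ y, g y ∂ν) ^ 2) ∧
    ∫ y, ((m : ℝ)⁻¹ * ∑ i, g (y i) - ∫ y, g y ∂ν) ^ 4 ∂(Measure.pi fun _ : Fin m => ν)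
      ≤ 48 * B ^ 4 * ((m : ℝ) ^ 2)⁻¹ := by
  have hgb : BddMeas g := ⟨hg, B, hB⟩
  set a := ∫ y, g y ∂ν with ha
  have hm' : (m : ℝ) ≠ 0 := by positivity
  have haB : |a| ≤ B := by
    simpa using norm_integral_le_of_norm_le_const (μ := ν) (f := g) (.of_forall hB)
  have hcb : BddMeas fun y => g y - a := hgb.sub (.const a)
  have h0 : ∫ y, (g y - a) ∂ν = 0 := by
    rw [integral_sub (hgb.integrable ν) (integrable_const _)]
    simp [ha]
  obtain ⟨h1, h2, h4⟩ := centered_sum_moments (ι := Fin m) ν hcb.1 (B := 2 * B)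
    (fun y => (abs_sub _ _).trans (by linarith [hB y])) h0 Finset.univ
  have e : ∀ y : Fin m → Y, (m : ℝ)⁻¹ * ∑ i, g (y i) - a = (m : ℝ)⁻¹ * ∑ i, (g (y i) - a) := by
    intro y
    rw [Finset.sum_sub_distrib]
    simp
    field_simp
  have hv : ∫ y, (g y - a) ^ 2 ∂ν = ∫ y, g y ^ 2 ∂ν - a ^ 2 := by
    have e' : ∀ y, (g y - a) ^ 2 = (g y ^ 2 - 2 * a * g y) + a ^ 2 := fun y => by ring
    simp only [e']
    have i1 : Integrable (fun y => g y ^ 2 - 2 * a * g y) ν :=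
      ((hgb.pow 2).integrable ν).sub ((hgb.integrable ν).const_mul _)
    rw [integral_add i1 (integrable_const _), integral_sub ((hgb.pow 2).integrable ν)
      ((hgb.integrable ν).const_mul _), integral_const_mul, ← ha]
    simp
    ring
  simp only [e, mul_pow, integral_const_mul, h1, h2, hv]
  refine ⟨by simp, ?_, ?_⟩
  · simp
    field_simp
  · refine (mul_le_mul_of_nonneg_left h4 (by positivity)).trans (le_of_eq ?_)
    simp
    field_simp
    ring

end Moments

/-- The potential `G_p` is measurable, bounded and strictly positive for every `p < k`. -/
def IsPotential (G : ℕ → X → ℝ) (k : ℕ) : Prop :=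
  ∀ p < k, BddMeas (G p) ∧ ∀ x, 0 < G p x

lemma IsPotential.mono {G : ℕ → X → ℝ} {k l : ℕ} (hG : IsPotential G l) (h : k ≤ l) :
    IsPotential G k :=
  fun p hp => hG p (hp.trans_le h)

/-- The operator `Q_{k+1} f = G_k · M_{k+1} f`. -/
def qOp (M : ℕ → Kernel X X) (G : ℕ → X → ℝ) (k : ℕ) (f : X → ℝ) : X → ℝ :=
  fun x => G k x * ∫ y, f y ∂(M (k + 1) x)

lemma BddMeas.qOp {M : ℕ → Kernel X X} [∀ p, IsMarkovKernel (M p)] {G : ℕ → X → ℝ} {k : ℕ}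
    (hG : BddMeas (G k)) {f : X → ℝ} (hf : BddMeas f) : BddMeas (qOp M G k f) :=
  hG.mul (hf.integral_kernel (M (k + 1)))

section OneParticle

lemma sum_ofReal_ne_zero {g : ℕ → ℝ} (hpos : ∀ j, 0 < g j) {m : ℕ} (hm : 0 < m) :
    (∑ j ∈ Finset.range m, ENNReal.ofReal (g j)) ≠ 0 := by
  intro h
  have := (Finset.sum_eq_zero_iff.mp h) 0 (by simpa using hm)
  exact absurd (ENNReal.ofReal_eq_zero.mp this) (not_le.mpr (hpos _))

/-- Joint law of the ancestor index and the position of one particle of generation `p + 1`,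
given the particles `z` of generation `p`. -/
def pfOne (M : ℕ → Kernel X X) (G : ℕ → X → ℝ) (Np : ℕ → ℕ) (p : ℕ) (z : ℕ → X) :
    Measure (ℕ × X) :=
  (cat (Np p) fun j => G p (z j)).bind fun a => (M (p + 1) (z a)).map fun x => (a, x)

variable (M : ℕ → Kernel X X) {G : ℕ → X → ℝ} {Np : ℕ → ℕ} {p : ℕ}

lemma pfOne_eq (z : ℕ → X) :
    pfOne M G Np p z = (∑ j ∈ Finset.range (Np p), ENNReal.ofReal (G p (z j)))⁻¹ •
      ∑ j ∈ Finset.range (Np p), ENNReal.ofReal (G p (z j)) •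
        (M (p + 1) (z j)).map fun x => (j, x) := by
  ext s hs
  rw [pfOne, Measure.bind_apply hs (measurable_of_countable _).aemeasurable]
  simp [cat, lintegral_finsetSum_measure]

lemma measurable_pfOne_apply (hG : Measurable (G p)) {s : Set (ℕ × X)} (hs : MeasurableSet s) :
    Measurable fun z => pfOne M G Np p z s := by
  have h : ∀ (j : ℕ) (z : ℕ → X), (M (p + 1) (z j)).map (fun x => (j, x)) s
      = M (p + 1) (z j) (Prod.mk j ⁻¹' s) := fun j z =>
    Measure.map_apply measurable_prodMk_left hs
  simp only [pfOne_eq, Measure.smul_apply, Measure.finsetSum_apply, h, smul_eq_mul]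
  have hw : ∀ j : ℕ, Measurable fun z : ℕ → X => ENNReal.ofReal (G p (z j)) := fun j =>
    (hG.comp (measurable_pi_apply j)).ennreal_ofReal
  have hM : ∀ j : ℕ, Measurable fun z : ℕ → X => M (p + 1) (z j) (Prod.mk j ⁻¹' s) := fun j =>
    ((M (p + 1)).measurable_coe (measurable_prodMk_left hs)).comp (measurable_pi_apply j)
  exact (Finset.measurable_sum _ fun j _ => hw j).inv.mul
    (Finset.measurable_sum _ fun j _ => (hw j).mul (hM j))

variable [∀ p, IsMarkovKernel (M p)]

lemma isProbabilityMeasure_pfOne (hpos : ∀ x, 0 < G p x) (hN : 0 < Np p) (z : ℕ → X) :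
    IsProbabilityMeasure (pfOne M G Np p z) := by
  refine ⟨?_⟩
  have h : ∀ j : ℕ, (M (p + 1) (z j)).map (fun x => (j, x)) Set.univ = 1 := fun j => by
    rw [Measure.map_apply measurable_prodMk_left MeasurableSet.univ]
    simp
  rw [pfOne_eq]
  simp only [Measure.smul_apply, Measure.finsetSum_apply, h, smul_eq_mul, mul_one]
  exact ENNReal.inv_mul_cancel (sum_ofReal_ne_zero (fun j => hpos (z j)) hN)
    (ENNReal.sum_ne_top.mpr fun _ _ => ENNReal.ofReal_ne_top)

lemma integral_pfOne_snd (hpos : ∀ x, 0 < G p x) (z : ℕ → X) {f : X → ℝ}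
    (hf : BddMeas f) :
    ∫ y, f y.2 ∂(pfOne M G Np p z) = (∑ j ∈ Finset.range (Np p), G p (z j))⁻¹ *
      ∑ j ∈ Finset.range (Np p), qOp M G p f (z j) := by
  have hfs : ∀ j : ℕ, Integrable (fun y : ℕ × X => f y.2)
      ((M (p + 1) (z j)).map fun x => (j, x)) := fun j => by
    have : IsProbabilityMeasure ((M (p + 1) (z j)).map fun x => (j, x)) :=
      Measure.isProbabilityMeasure_map measurable_prodMk_left.aemeasurable
    exact (hf.comp measurable_snd).integrable _
  have hI : ∀ j : ℕ, ∫ y, f y.2 ∂((M (p + 1) (z j)).map fun x => (j, x))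
      = ∫ x, f x ∂(M (p + 1) (z j)) := fun j =>
    integral_map measurable_prodMk_left.aemeasurable
      (hf.comp measurable_snd).1.aestronglyMeasurable
  rw [pfOne_eq, integral_smul_measure, integral_finsetSum_measure
    fun j _ => (hfs j).smul_measure ENNReal.ofReal_ne_top]
  rw [ENNReal.toReal_inv, ENNReal.toReal_sum fun _ _ => ENNReal.ofReal_ne_top]
  simp only [integral_smul_measure, hI, smul_eq_mul, qOp]
  simp only [ENNReal.toReal_ofReal (hpos _).le]

end OneParticle

section Step

lemma measurable_padF {Y : Type*} [MeasurableSpace Y] [Nonempty Y] {m : ℕ} :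
    Measurable (padF : (Fin m → Y) → ℕ → Y) := by
  refine measurable_pi_iff.mpr fun i => ?_
  by_cases h : i < m
  · simpa only [padF, h, dif_pos] using measurable_pi_apply _
  · simpa only [padF, h, dif_neg, not_false_iff] using measurable_const

lemma measurable_pad_pair [Nonempty X] {m : ℕ} : Measurable fun f : Fin m → ℕ × X =>
    ((padF fun i => (f i).1, padF fun i => (f i).2) : (ℕ → ℕ) × (ℕ → X)) :=
  (measurable_padF.comp (measurable_pi_iff.mpr fun i =>
      measurable_fst.comp (measurable_pi_apply i))).prodMk
    (measurable_padF.comp (measurable_pi_iff.mpr fun i =>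
      measurable_snd.comp (measurable_pi_apply i)))

variable [Nonempty X] (M : ℕ → Kernel X X) [∀ p, IsMarkovKernel (M p)] {G : ℕ → X → ℝ}
  {Np : ℕ → ℕ} {p : ℕ}

lemma measurable_pfStep (hG : Measurable (G p)) (hpos : ∀ x, 0 < G p x) (hN : 0 < Np p) :
    Measurable fun z => pfStep M G Np p z := by
  have := fun z => isProbabilityMeasure_pfOne (M := M) (Np := Np) hpos hN z
  refine (Measure.measurable_map _ measurable_pad_pair).comp
    (?_ : Measurable fun z => Measure.pi fun _ : Fin (Np (p + 1)) => pfOne M G Np p z)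
  refine Measurable.measure_of_isPiSystem_of_isProbabilityMeasure generateFrom_pi.symm
    isPiSystem_pi ?_
  rintro _ ⟨s, hs, rfl⟩
  simp only [Measure.pi_pi]
  exact Finset.measurable_prod _ fun i _ => measurable_pfOne_apply M hG (hs i trivial)

lemma isProbabilityMeasure_pfStep (hpos : ∀ x, 0 < G p x) (hN : 0 < Np p) (z : ℕ → X) :
    IsProbabilityMeasure (pfStep M G Np p z) := by
  have := isProbabilityMeasure_pfOne M (Np := Np) hpos hN z
  exact Measure.isProbabilityMeasure_map (μ := Measure.pi fun _ => pfOne M G Np p z)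
    measurable_pad_pair.aemeasurable

/-- `pfStep` as a kernel. -/
def pfStepKernel (hG : Measurable (G p)) (hpos : ∀ x, 0 < G p x) (hN : 0 < Np p) :
    Kernel (ℕ → X) ((ℕ → ℕ) × (ℕ → X)) :=
  ⟨fun z => pfStep M G Np p z, measurable_pfStep M hG hpos hN⟩

instance (hG : Measurable (G p)) (hpos : ∀ x, 0 < G p x) (hN : 0 < Np p) :
    IsMarkovKernel (pfStepKernel M hG hpos hN) :=
  ⟨fun z => isProbabilityMeasure_pfStep M hpos hN z⟩

end Step

lemma BddMeas.continuous_comp {Y : Type*} [MeasurableSpace Y] {f : Y → ℝ} (hf : BddMeas f)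
    {H : ℝ → ℝ} (hH : Continuous H) : BddMeas fun y => H (f y) := by
  obtain ⟨hf, C, hC⟩ := hf
  obtain ⟨D, hD⟩ :=
    (isCompact_Icc (a := -C) (b := C)).exists_bound_of_continuousOn hH.continuousOn
  exact ⟨hH.measurable.comp hf, D, fun y => hD _ (abs_le.mp (hC y))⟩

section Estimates

variable {G : ℕ → X → ℝ} {k : ℕ}

lemma abs_etaN_le {Y : Type*} {f : Y → ℝ} {C : ℝ} (hC : ∀ x, |f x| ≤ C) (hC0 : 0 ≤ C)
    (Np : ℕ → ℕ) (k : ℕ) (ω : (ℕ → ℕ → Y) × (ℕ → ℕ → ℕ)) : |etaN Np k f ω| ≤ C := by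
  rcases Nat.eq_zero_or_pos (Np k) with h | h
  · simpa [etaN, h] using hC0
  · have h' : (0 : ℝ) < Np k := by exact_mod_cast h
    rw [etaN, abs_mul, abs_of_nonneg (inv_nonneg.mpr h'.le), inv_mul_le_iff₀ h']
    refine (Finset.abs_sum_le_sum_abs _ _).trans
      ((Finset.sum_le_sum fun i _ => hC (ω.1 k i)).trans (by simp))

lemma measurable_etaN {f : X → ℝ} (hf : Measurable f) (Np : ℕ → ℕ) (k : ℕ) :
    Measurable fun ω : (ℕ → ℕ → X) × (ℕ → ℕ → ℕ) => etaN Np k f ω :=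
  (Finset.measurable_sum _ fun i _ => hf.comp ((measurable_pi_apply i).comp
    ((measurable_pi_apply k).comp measurable_fst))).const_mul _

lemma measurable_gammaN (hG : IsPotential G k) {f : X → ℝ} (hf : Measurable f) (Np : ℕ → ℕ) :
    Measurable fun ω : (ℕ → ℕ → X) × (ℕ → ℕ → ℕ) => gammaN G Np k f ω :=
  (Finset.measurable_prod _ fun p hp =>
    measurable_etaN (hG p (Finset.mem_range.mp hp)).1.1 Np p).mul (measurable_etaN hf Np k)

lemma exists_abs_gammaN_le [Nonempty X] (hG : IsPotential G k) {f : X → ℝ} (hf : BddMeas f) :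
    ∃ C, ∀ (Np : ℕ → ℕ) ω, |gammaN G Np k f ω| ≤ C := by
  have h1 : ∃ C, ∀ (Np : ℕ → ℕ) (ω : (ℕ → ℕ → X) × (ℕ → ℕ → ℕ)),
      |∏ p ∈ Finset.range k, etaN Np p (G p) ω| ≤ C := by
    induction k with
    | zero => exact ⟨1, fun _ _ => by simp⟩
    | succ k ih =>
      obtain ⟨C, hC⟩ := ih (hG.mono k.le_succ)
      obtain ⟨D, hD⟩ := (hG k k.lt_succ_self).1.2
      have hD0 : 0 ≤ D := (abs_nonneg _).trans (hD (Classical.arbitrary X))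
      refine ⟨C * D, fun Np ω => ?_⟩
      rw [Finset.prod_range_succ, abs_mul]
      exact mul_le_mul (hC Np ω) (abs_etaN_le hD hD0 Np k ω) (abs_nonneg _)
        ((abs_nonneg _).trans (hC Np ω))
  obtain ⟨C, hC⟩ := h1
  obtain ⟨D, hD⟩ := hf.2
  have hD0 : 0 ≤ D := (abs_nonneg _).trans (hD (Classical.arbitrary X))
  refine ⟨C * D, fun Np ω => ?_⟩
  rw [gammaN, abs_mul]
  exact mul_le_mul (hC Np ω) (abs_etaN_le hD hD0 Np k ω) (abs_nonneg _)
    ((abs_nonneg _).trans (hC Np ω))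

lemma bddMeas_gammaN [Nonempty X] (hG : IsPotential G k) {f : X → ℝ} (hf : BddMeas f)
    (Np : ℕ → ℕ) :
    BddMeas fun ω : (ℕ → ℕ → X) × (ℕ → ℕ → ℕ) => gammaN G Np k f ω :=
  ⟨measurable_gammaN hG hf.1 Np, (exists_abs_gammaN_le hG hf).imp fun _ h => h Np⟩

lemma gammaN_succ_update {Y : Type*} {G : ℕ → Y → ℝ} {Np : ℕ → ℕ} {k : ℕ} (f : Y → ℝ)
    (ω : (ℕ → ℕ → Y) × (ℕ → ℕ → ℕ)) (a : ℕ → ℕ) (z : ℕ → Y) :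
    gammaN G Np (k + 1) f (Function.update ω.1 (k + 1) z, Function.update ω.2 k a)
      = gammaN G Np k (G k) ω *
        ((Np (k + 1) : ℝ)⁻¹ * ∑ i ∈ Finset.range (Np (k + 1)), f (z i)) := by
  rw [gammaN, gammaN, Finset.prod_range_succ]
  have h : ∀ p < k + 1, etaN Np p (G p) (Function.update ω.1 (k + 1) z, Function.update ω.2 k a)
      = etaN Np p (G p) ω := fun p hp => by
    simp [etaN, Function.update_of_ne hp.ne]
  rw [Finset.prod_congr rfl fun p hp => h p ((Finset.mem_range.mp hp).trans k.lt_succ_self),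
    h k k.lt_succ_self]
  simp [etaN]

lemma gammaN_mul_integral_pfOne {M : ℕ → Kernel X X} [∀ p, IsMarkovKernel (M p)] {Np : ℕ → ℕ}
    (hpos : ∀ x, 0 < G k x) (hN : 0 < Np k) {f : X → ℝ} (hf : BddMeas f)
    (ω : (ℕ → ℕ → X) × (ℕ → ℕ → ℕ)) :
    gammaN G Np k (G k) ω * ∫ y, f y.2 ∂(pfOne M G Np k (ω.1 k))
      = gammaN G Np k (qOp M G k f) ω := by
  have h : ∑ j ∈ Finset.range (Np k), G k (ω.1 k j) ≠ 0 :=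
    (Finset.sum_pos (fun j _ => hpos _) ⟨0, by simpa using hN⟩).ne'
  rw [integral_pfOne_snd M hpos _ hf]
  simp only [gammaN, etaN]
  field_simp

lemma measurable_update_config (k : ℕ) : Measurable (Function.uncurry fun
    (ω : (ℕ → ℕ → X) × (ℕ → ℕ → ℕ)) (az : (ℕ → ℕ) × (ℕ → X)) =>
      ((Function.update ω.1 (k + 1) az.2, Function.update ω.2 k az.1) :
        (ℕ → ℕ → X) × (ℕ → ℕ → ℕ))) :=
  (measurable_update'.comp ((measurable_fst.comp measurable_fst).prodMk
    (measurable_snd.comp measurable_snd))).prodMk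
  (measurable_update'.comp ((measurable_snd.comp measurable_fst).prodMk
    (measurable_fst.comp measurable_snd)))

end Estimates

section Law

variable [Nonempty X] {M0 : Measure X} {M : ℕ → Kernel X X} {G : ℕ → X → ℝ} {Np : ℕ → ℕ} {k : ℕ}

lemma measurable_initial_config {m : ℕ} : Measurable fun f : Fin m → X =>
    ((fun p => if p = 0 then padF f else fun _ => Classical.arbitrary X, fun _ _ => 0) :
      (ℕ → ℕ → X) × (ℕ → ℕ → ℕ)) := by
  refine (measurable_pi_iff.mpr fun p => ?_).prodMk measurable_const
  by_cases hp : p = 0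
  · simpa only [hp, if_true] using measurable_padF
  · simpa only [hp, if_false] using measurable_const

lemma integral_pfLaw_zero {H : ℝ → ℝ} (hH : Continuous H) {f : X → ℝ} (hf : BddMeas f) :
    ∫ ω, H (gammaN G Np 0 f ω) ∂(pfLaw M0 M G Np 0)
      = ∫ y, H ((Np 0 : ℝ)⁻¹ * ∑ i, f (y i)) ∂(Measure.pi fun _ : Fin (Np 0) => M0) := by
  have hG : IsPotential G 0 := fun p hp => absurd hp p.not_lt_zero
  rw [pfLaw, integral_map measurable_initial_config.aemeasurable
    ((bddMeas_gammaN hG hf Np).continuous_comp hH).1.aestronglyMeasurable]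
  simp [gammaN, etaN, Finset.sum_range, padF]

variable [IsProbabilityMeasure M0] [∀ p, IsMarkovKernel (M p)]

lemma isProbabilityMeasure_pfLaw (hG : IsPotential G k) (hN : ∀ p < k, 0 < Np p) :
    IsProbabilityMeasure (pfLaw M0 M G Np k) := by
  induction k with
  | zero => exact Measure.isProbabilityMeasure_map measurable_initial_config.aemeasurable
  | succ k ih =>
    have := ih (hG.mono k.le_succ) fun p hp => hN p (hp.trans k.lt_succ_self)
    obtain ⟨hGk, hpos⟩ := hG k k.lt_succ_self
    exact isProbabilityMeasure_bind_map (pfLaw M0 M G Np k)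
      ((pfStepKernel M hGk.1 hpos (hN k k.lt_succ_self)).comap (fun ω => ω.1 k)
        ((measurable_pi_apply k).comp measurable_fst)) (measurable_update_config k)

lemma integral_pfLaw_succ (hG : IsPotential G (k + 1)) (hN : ∀ p < k + 1, 0 < Np p)
    {H : ℝ → ℝ} (hH : Continuous H) {f : X → ℝ} (hf : BddMeas f) :
    ∫ ω, H (gammaN G Np (k + 1) f ω) ∂(pfLaw M0 M G Np (k + 1))
      = ∫ ω, ∫ y, H (gammaN G Np k (G k) ω * ((Np (k + 1) : ℝ)⁻¹ * ∑ i, f (y i).2))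
        ∂(Measure.pi fun _ : Fin (Np (k + 1)) => pfOne M G Np k (ω.1 k))
        ∂(pfLaw M0 M G Np k) := by
  obtain ⟨hGk, hpos⟩ := hG k k.lt_succ_self
  have : IsProbabilityMeasure (pfLaw M0 M G Np k) := isProbabilityMeasure_pfLaw
    (hG.mono k.le_succ) fun p hp => hN p (hp.trans k.lt_succ_self)
  refine (integral_bind_map (pfLaw M0 M G Np k)
      ((pfStepKernel M hGk.1 hpos (hN k k.lt_succ_self)).comap (fun ω => ω.1 k)
        ((measurable_pi_apply k).comp measurable_fst)) (measurable_update_config k)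
      ((bddMeas_gammaN hG hf Np).continuous_comp hH)).trans
    (integral_congr_ae (.of_forall fun ω => ?_))
  simp only [gammaN_succ_update]
  change ∫ az : (ℕ → ℕ) × (ℕ → X), _ ∂(pfStep M G Np k (ω.1 k)) = _
  rw [pfStep, integral_map measurable_pad_pair.aemeasurable]
  · simp [Finset.sum_range, padF, pfOne]
  · refine (hH.measurable.comp (((Finset.measurable_sum _ fun i _ => hf.1.comp
      ((measurable_pi_apply i).comp measurable_snd)).const_mul _).const_mul _)).aestronglyMeasurable

end Law

lemma affine_sample_mean_moments {Y : Type*} [MeasurableSpace Y] (ν : Measure Y)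
    [IsProbabilityMeasure ν] {g : Y → ℝ} (hg : Measurable g) {B : ℝ} (hB : ∀ y, |g y| ≤ B)
    {m : ℕ} (hm : 0 < m) (P a : ℝ) :
    ∫ y, (P * ((m : ℝ)⁻¹ * ∑ i, g (y i))) ∂(Measure.pi fun _ : Fin m => ν)
      = P * ∫ y, g y ∂ν ∧
    ∫ y, (P * ((m : ℝ)⁻¹ * ∑ i, g (y i)) - a) ^ 2 ∂(Measure.pi fun _ : Fin m => ν)
      = (P * ∫ y, g y ∂ν - a) ^ 2
        + (m : ℝ)⁻¹ * (P * (P * ∫ y, g y ^ 2 ∂ν) - (P * ∫ y, g y ∂ν) ^ 2) ∧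
    ∫ y, (P * ((m : ℝ)⁻¹ * ∑ i, g (y i)) - a) ^ 4 ∂(Measure.pi fun _ : Fin m => ν)
      ≤ 8 * (P * ∫ y, g y ∂ν - a) ^ 4 + 8 * P ^ 4 * (48 * B ^ 4 * ((m : ℝ) ^ 2)⁻¹) := by
  obtain ⟨h1, h2, h4⟩ := sample_mean_moments ν hg hB hm
  set s := ∫ y, g y ∂ν
  set π := Measure.pi fun _ : Fin m => ν
  have hA : BddMeas fun y : Fin m → Y => (m : ℝ)⁻¹ * ∑ i, g (y i) - s :=
    ((BddMeas.const _).mul (BddMeas.sum _ fun i _ =>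
      (show BddMeas g from ⟨hg, B, hB⟩).comp (measurable_pi_apply i))).sub (.const s)
  refine ⟨?_, ?_, ?_⟩
  · have e : ∀ y : Fin m → Y, P * ((m : ℝ)⁻¹ * ∑ i, g (y i))
        = P * ((m : ℝ)⁻¹ * ∑ i, g (y i) - s) + P * s := fun y => by ring
    simp only [e]
    rw [integral_add ((hA.integrable π).const_mul P) (integrable_const _), integral_const_mul, h1]
    simp
  · have e : ∀ y : Fin m → Y, (P * ((m : ℝ)⁻¹ * ∑ i, g (y i)) - a) ^ 2
        = (P ^ 2 * ((m : ℝ)⁻¹ * ∑ i, g (y i) - s) ^ 2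
          + 2 * P * (P * s - a) * ((m : ℝ)⁻¹ * ∑ i, g (y i) - s)) + (P * s - a) ^ 2 :=
      fun y => by ring
    simp only [e]
    have i2 : Integrable (fun y : Fin m → Y =>
        P ^ 2 * ((m : ℝ)⁻¹ * ∑ i, g (y i) - s) ^ 2) π := ((hA.pow 2).integrable π).const_mul _
    have i1 : Integrable (fun y : Fin m → Y =>
        2 * P * (P * s - a) * ((m : ℝ)⁻¹ * ∑ i, g (y i) - s)) π :=
      (hA.integrable π).const_mul _
    have i3 : Integrable (fun y : Fin m → Y => P ^ 2 * ((m : ℝ)⁻¹ * ∑ i, g (y i) - s) ^ 2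
        + 2 * P * (P * s - a) * ((m : ℝ)⁻¹ * ∑ i, g (y i) - s)) π := i2.add i1
    rw [integral_add i3 (integrable_const _), integral_add i2 i1, integral_const_mul,
      integral_const_mul, h1, h2]
    simp
    ring
  · have e : ∀ y : Fin m → Y, (P * ((m : ℝ)⁻¹ * ∑ i, g (y i)) - a) ^ 4
        ≤ 8 * (P * s - a) ^ 4 + 8 * P ^ 4 * ((m : ℝ)⁻¹ * ∑ i, g (y i) - s) ^ 4 := fun y => by
      have h : ∀ x z : ℝ, (x + z) ^ 4 ≤ 8 * x ^ 4 + 8 * z ^ 4 := fun x z => by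
        nlinarith [sq_nonneg (x ^ 2 - z ^ 2), sq_nonneg (x - z), sq_nonneg ((x - z) ^ 2),
          sq_nonneg (x ^ 2 + z ^ 2 - 2 * x * z), mul_nonneg (sq_nonneg (x - z)) (sq_nonneg (x + z)),
          mul_nonneg (sq_nonneg (x - z)) (add_nonneg (sq_nonneg x) (sq_nonneg z))]
      have := h (P * s - a) (P * ((m : ℝ)⁻¹ * ∑ i, g (y i) - s))
      rw [mul_pow P] at this
      refine le_trans (le_of_eq ?_) (this.trans (le_of_eq (by ring)))
      ring
    have hb : BddMeas fun y : Fin m → Y => P * ((m : ℝ)⁻¹ * ∑ i, g (y i)) - a := by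
      have := ((BddMeas.const P).mul (hA.add (.const s))).sub (.const a)
      simpa only [sub_add_cancel] using this
    have i4 : Integrable (fun y : Fin m → Y =>
        8 * P ^ 4 * ((m : ℝ)⁻¹ * ∑ i, g (y i) - s) ^ 4) π :=
      ((hA.pow 4).integrable π).const_mul _
    refine (integral_mono ((hb.pow 4).integrable π) ((integrable_const _).add i4) e).trans ?_
    simp only [Pi.add_apply]
    rw [integral_add (integrable_const _) i4, integral_const_mul (8 * P ^ 4)]
    have := mul_le_mul_of_nonneg_left h4 (show 0 ≤ 8 * P ^ 4 by positivity)
    simpa using this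

section FeynmanKac

variable {M0 : Measure X} [IsProbabilityMeasure M0]
  {M : ℕ → Kernel X X} [∀ p, IsMarkovKernel (M p)] {G : ℕ → X → ℝ} {k : ℕ}

lemma isFiniteMeasure_gammaFK (hG : IsPotential G k) : IsFiniteMeasure (gammaFK M0 M G k) := by
  induction k with
  | zero => exact inferInstanceAs (IsFiniteMeasure M0)
  | succ k ih =>
    have := ih (hG.mono k.le_succ)
    have := isFiniteMeasure_withDensity_ofReal
      ((hG k k.lt_succ_self).1.integrable (gammaFK M0 M G k)).2
    exact inferInstanceAs (IsFiniteMeasure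
      (((gammaFK M0 M G k).withDensity fun x => ENNReal.ofReal (G k x)).bind (M (k + 1))))

lemma gInt_succ (hG : IsPotential G (k + 1)) {f : X → ℝ} (hf : BddMeas f) :
    gInt M0 M G (k + 1) f = gInt M0 M G k (qOp M G k f) := by
  obtain ⟨hGk, hpos⟩ := hG k k.lt_succ_self
  have := isFiniteMeasure_gammaFK (M0 := M0) (M := M) (hG.mono k.le_succ)
  have := isFiniteMeasure_withDensity_ofReal (hGk.integrable (gammaFK M0 M G k)).2
  refine (integral_bind_kernel _ (M (k + 1)) hf).trans ?_
  rw [integral_withDensity_eq_integral_toReal_smul hGk.1.ennreal_ofReal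
    (.of_forall fun x => ENNReal.ofReal_lt_top)]
  simp [gInt, qOp, fun x => (hpos x).le]

lemma gInt_pos [Nonempty X] (hG : IsPotential G k) {f : X → ℝ} (hf : BddMeas f)
    (hf0 : ∀ x, 0 < f x) : 0 < gInt M0 M G k f := by
  have key : ∀ (μ : Measure X) [IsProbabilityMeasure μ] {f : X → ℝ}, BddMeas f →
      (∀ x, 0 < f x) → 0 < ∫ x, f x ∂μ := fun μ _ f hf h0 => by
    rw [integral_pos_iff_support_of_nonneg (fun x => (h0 x).le) (hf.integrable μ),
      show Function.support f = Set.univ from Set.eq_univ_of_forall fun x => (h0 x).ne',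
      measure_univ]
    exact zero_lt_one
  induction k generalizing f with
  | zero => exact key M0 hf hf0
  | succ k ih =>
    rw [gInt_succ hG hf]
    obtain ⟨hGk, hpos⟩ := hG k k.lt_succ_self
    exact ih (hG.mono k.le_succ) (hGk.qOp hf) fun x => mul_pos (hpos x) (key _ hf hf0)

end FeynmanKac

section Moments

variable [Nonempty X] {M0 : Measure X} [IsProbabilityMeasure M0]
  {M : ℕ → Kernel X X} {G : ℕ → X → ℝ} {Np : ℕ → ℕ} {k : ℕ}

lemma integral_gammaN_sub_sq_zero (hN : 0 < Np 0) {f : X → ℝ} (hf : BddMeas f) (a : ℝ) :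
    ∫ ω, (gammaN G Np 0 f ω - a) ^ 2 ∂(pfLaw M0 M G Np 0)
      = (∫ x, f x ∂M0 - a) ^ 2 + (Np 0 : ℝ)⁻¹ * (∫ x, f x ^ 2 ∂M0 - (∫ x, f x ∂M0) ^ 2) := by
  obtain ⟨B, hB⟩ := hf.2
  have h := (affine_sample_mean_moments M0 hf.1 hB hN 1 a).2.1
  simp only [one_mul] at h
  rw [integral_pfLaw_zero (H := fun x => (x - a) ^ 2) (by fun_prop) hf, h]

variable [∀ p, IsMarkovKernel (M p)]

lemma integral_gammaN (hG : IsPotential G k) (hN : ∀ p ≤ k, 0 < Np p) {f : X → ℝ}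
    (hf : BddMeas f) :
    ∫ ω, gammaN G Np k f ω ∂(pfLaw M0 M G Np k) = gInt M0 M G k f := by
  obtain ⟨B, hB⟩ := hf.2
  induction k generalizing f B with
  | zero =>
    have h := (affine_sample_mean_moments M0 hf.1 hB (hN 0 le_rfl) 1 0).1
    simp only [one_mul] at h
    rw [integral_pfLaw_zero (H := fun x => x) continuous_id hf, h]
    rfl
  | succ k ih =>
    have hN' : ∀ p < k + 1, 0 < Np p := fun p hp => hN p hp.le
    obtain ⟨hGk, hpos⟩ := hG k k.lt_succ_self
    obtain ⟨C, hC⟩ := (hGk.qOp (M := M) hf).2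
    rw [integral_pfLaw_succ (H := fun x => x) hG hN' continuous_id hf, gInt_succ hG hf,
      ← ih (hG.mono k.le_succ) (fun p hp => hN p (hp.trans k.le_succ)) (hGk.qOp hf) C hC]
    refine integral_congr_ae (.of_forall fun ω => ?_)
    have := isProbabilityMeasure_pfOne M hpos (hN' k k.lt_succ_self) (ω.1 k)
    simp only []
    rw [(affine_sample_mean_moments (pfOne M G Np k (ω.1 k)) (g := fun y => f y.2)
      (hf.1.comp measurable_snd) (fun y => hB y.2) (hN (k + 1) le_rfl) _ 0).1,
      gammaN_mul_integral_pfOne hpos (hN' k k.lt_succ_self) hf]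

lemma integral_gammaN_sub_sq_succ (hG : IsPotential G (k + 1)) (hN : ∀ p ≤ k + 1, 0 < Np p)
    {f : X → ℝ} (hf : BddMeas f) (a : ℝ) :
    ∫ ω, (gammaN G Np (k + 1) f ω - a) ^ 2 ∂(pfLaw M0 M G Np (k + 1))
      = ∫ ω, (gammaN G Np k (qOp M G k f) ω - a) ^ 2 ∂(pfLaw M0 M G Np k)
        + (Np (k + 1) : ℝ)⁻¹ *
          (∫ ω, gammaN G Np k (G k) ω * gammaN G Np k (qOp M G k fun x => f x ^ 2) ω
              ∂(pfLaw M0 M G Np k)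
            - ∫ ω, gammaN G Np k (qOp M G k f) ω ^ 2 ∂(pfLaw M0 M G Np k)) := by
  obtain ⟨B, hB⟩ := hf.2
  have hN' : ∀ p < k + 1, 0 < Np p := fun p hp => hN p hp.le
  have hGk' := hG.mono k.le_succ
  obtain ⟨hGk, hpos⟩ := hG k k.lt_succ_self
  have := isProbabilityMeasure_pfLaw (M0 := M0) (M := M) hGk'
    fun p hp => hN' p (hp.trans k.lt_succ_self)
  have b1 := bddMeas_gammaN hGk' (hGk.qOp (M := M) hf) Np
  have b2 := bddMeas_gammaN hGk' (hGk.qOp (M := M) (hf.pow 2)) Np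
  have b3 := bddMeas_gammaN hGk' hGk Np
  rw [← integral_sub ((b3.mul b2).integrable _) ((b1.pow 2).integrable _), ← integral_const_mul,
    ← integral_add (((b1.sub (.const a)).pow 2).integrable _)
      ((((b3.mul b2).sub (b1.pow 2)).integrable _).const_mul _),
    integral_pfLaw_succ (H := fun x => (x - a) ^ 2) hG hN' (by fun_prop) hf]
  refine integral_congr_ae (.of_forall fun ω => ?_)
  have := isProbabilityMeasure_pfOne M hpos (hN' k k.lt_succ_self) (ω.1 k)
  simp only []
  rw [(affine_sample_mean_moments (pfOne M G Np k (ω.1 k)) (g := fun y => f y.2)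
    (hf.1.comp measurable_snd) (fun y => hB y.2) (hN (k + 1) le_rfl) _ a).2.1,
    gammaN_mul_integral_pfOne hpos (hN' k k.lt_succ_self) hf,
    gammaN_mul_integral_pfOne (f := fun x => f x ^ 2) hpos (hN' k k.lt_succ_self) (hf.pow 2)]

lemma exists_integral_gammaN_sub_pow_four_le (hG : IsPotential G k) {f : X → ℝ}
    (hf : BddMeas f) :
    ∃ C, 0 ≤ C ∧ ∀ Np : ℕ → ℕ, (∀ p ≤ k, 0 < Np p) →
      ∫ ω, (gammaN G Np k f ω - gInt M0 M G k f) ^ 4 ∂(pfLaw M0 M G Np k)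
        ≤ C * ∑ p ∈ Finset.range (k + 1), ((Np p : ℝ) ^ 2)⁻¹ := by
  obtain ⟨B, hB⟩ := hf.2
  induction k generalizing f B with
  | zero =>
    refine ⟨8 * (48 * B ^ 4), by positivity, fun Np hN => ?_⟩
    have h := (affine_sample_mean_moments M0 hf.1 hB (hN 0 le_rfl) 1 (gInt M0 M G 0 f)).2.2
    simp only [one_mul] at h
    rw [integral_pfLaw_zero (H := fun x => (x - gInt M0 M G 0 f) ^ 4) (by fun_prop) hf]
    refine h.trans (le_of_eq ?_)
    have : gInt M0 M G 0 f = ∫ x, f x ∂M0 := rfl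
    rw [this]
    simp
    ring
  | succ k ih =>
    have hGk' := hG.mono k.le_succ
    obtain ⟨hGk, hpos⟩ := hG k k.lt_succ_self
    obtain ⟨B', hB'⟩ := (hGk.qOp (M := M) hf).2
    obtain ⟨C, hC0, hC⟩ := ih hGk' (hGk.qOp (M := M) hf) B' hB'
    obtain ⟨D, hD⟩ := exists_abs_gammaN_le hGk' hGk
    refine ⟨8 * C + 8 * D ^ 4 * (48 * B ^ 4), by positivity, fun Np hN => ?_⟩
    have hN' : ∀ p < k + 1, 0 < Np p := fun p hp => hN p hp.le
    have := isProbabilityMeasure_pfLaw (M0 := M0) (M := M) hGk'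
      fun p hp => hN' p (hp.trans k.lt_succ_self)
    set a := gInt M0 M G (k + 1) f with ha
    have b1 := bddMeas_gammaN hGk' (hGk.qOp (M := M) hf) Np
    rw [integral_pfLaw_succ (H := fun x => (x - a) ^ 4) hG hN' (by fun_prop) hf]
    have hint : Integrable (fun ω => 8 * (gammaN G Np k (qOp M G k f) ω - a) ^ 4)
      (pfLaw M0 M G Np k) := (((b1.sub (.const a)).pow 4).integrable _).const_mul 8
    have hle : ∫ ω, ∫ y, (gammaN G Np k (G k) ω * ((Np (k + 1) : ℝ)⁻¹ * ∑ i, f (y i).2) - a) ^ 4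
          ∂(Measure.pi fun _ : Fin (Np (k + 1)) => pfOne M G Np k (ω.1 k)) ∂(pfLaw M0 M G Np k)
        ≤ ∫ ω, (8 * (gammaN G Np k (qOp M G k f) ω - a) ^ 4
          + 8 * D ^ 4 * (48 * B ^ 4 * ((Np (k + 1) : ℝ) ^ 2)⁻¹)) ∂(pfLaw M0 M G Np k) := by
      refine integral_mono_of_nonneg
        (.of_forall fun ω => integral_nonneg fun y => by positivity)
        (hint.add (integrable_const _)) (.of_forall fun ω => ?_)
      have := isProbabilityMeasure_pfOne M hpos (hN' k k.lt_succ_self) (ω.1 k)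
      have h := (affine_sample_mean_moments (pfOne M G Np k (ω.1 k)) (g := fun y => f y.2)
        (hf.1.comp measurable_snd) (fun y => hB y.2) (hN (k + 1) le_rfl)
        (gammaN G Np k (G k) ω) a).2.2
      rw [gammaN_mul_integral_pfOne hpos (hN' k k.lt_succ_self) hf] at h
      have hD4 : gammaN G Np k (G k) ω ^ 4 ≤ D ^ 4 := by
        rw [← Even.pow_abs (by decide : Even 4)]
        exact pow_le_pow_left₀ (abs_nonneg _) (hD Np ω) 4
      refine h.trans (add_le_add_right ?_ _)
      gcongr
    refine hle.trans ?_
    rw [integral_add hint (integrable_const _), integral_const_mul]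
    have h := hC Np fun p hp => hN p (hp.trans k.le_succ)
    rw [← gInt_succ hG hf, ← ha] at h
    simp only [integral_const, probReal_univ, one_smul]
    rw [Finset.sum_range_succ _ (k + 1)]
    have hs : 0 ≤ ∑ p ∈ Finset.range (k + 1), ((Np p : ℝ) ^ 2)⁻¹ :=
      Finset.sum_nonneg fun p _ => by positivity
    have hs' : 0 ≤ ((Np (k + 1) : ℝ) ^ 2)⁻¹ := by positivity
    have hD4 : 0 ≤ 8 * D ^ 4 * (48 * B ^ 4) := by positivity
    nlinarith [mul_nonneg hD4 hs, mul_nonneg hC0 hs']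

end Moments

section MarkovPath

variable {Y : Type*} [MeasurableSpace Y] {μ0 : Measure Y} [IsProbabilityMeasure μ0]
  {κ : ℕ → Kernel Y Y} [∀ p, IsMarkovKernel (κ p)]

lemma measurable_uncurry_update (k : ℕ) :
    Measurable (Function.uncurry fun (ω : ℕ → Y) (y : Y) => Function.update ω (k + 1) y) :=
  measurable_update'

lemma isProbabilityMeasure_markovPath (k : ℕ) :
    IsProbabilityMeasure (markovPath μ0 (fun p => κ p) k) := by
  induction k with
  | zero => exact Measure.isProbabilityMeasure_map (by fun_prop)
  | succ k ih =>
    exact isProbabilityMeasure_bind_map (markovPath μ0 (fun p => κ p) k)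
      ((κ (k + 1)).comap (fun ω => ω k) (measurable_pi_apply k)) (measurable_uncurry_update k)

lemma integral_markovPath_succ (k : ℕ) {F : (ℕ → Y) → ℝ} (hF : BddMeas F) :
    ∫ ω, F ω ∂(markovPath μ0 (fun p => κ p) (k + 1))
      = ∫ ω, ∫ y, F (Function.update ω (k + 1) y) ∂(κ (k + 1) (ω k))
          ∂(markovPath μ0 (fun p => κ p) k) :=
  have := isProbabilityMeasure_markovPath (μ0 := μ0) (κ := κ) k
  integral_bind_map (markovPath μ0 (fun p => κ p) k)
    ((κ (k + 1)).comap (fun ω => ω k) (measurable_pi_apply k)) (measurable_uncurry_update k) hF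

end MarkovPath

section PairChain

lemma muB_zero (M0 : Measure X) (M : ℕ → Kernel X X) (G : ℕ → X → ℝ) (b : ℕ → Bool)
    {f : X × X → ℝ} (hf : Measurable f) :
    muB M0 M G 0 b f = ∫ q, f q ∂(pairInit M0 b) := by
  rw [muB, markovPath, integral_map (by fun_prop)]
  · simp
  · simpa using (show Measurable fun ω : ℕ → X × X => f (ω 0) from
      hf.comp (measurable_pi_apply 0)).aestronglyMeasurable

variable {M0 : Measure X} [IsProbabilityMeasure M0]
  {M : ℕ → Kernel X X} [∀ p, IsMarkovKernel (M p)] {G : ℕ → X → ℝ} {k : ℕ} {b : ℕ → Bool}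

/-- `pairKer M b p` as a kernel. -/
def pairKernel (M : ℕ → Kernel X X) [∀ p, IsMarkovKernel (M p)] (b : ℕ → Bool) (p : ℕ) :
    Kernel (X × X) (X × X) :=
  ⟨pairKer M b p, by
    by_cases h : b p
    · let κ : Kernel (X × X) X := (M p).comap Prod.fst measurable_fst
      have e : pairKer M b p = fun q => (κ q).map ((fun (_ : X × X) y => (y, y)) q) := by
        ext1 q
        simp [pairKer, h, κ]
      rw [e]
      exact measurable_map_of_uncurry _ (measurable_snd.prodMk measurable_snd)
    · have e : pairKer M b p = fun q => (M p ∥ₖ M p) q := by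
        ext1 q
        simp [pairKer, h, Kernel.parallelComp_apply]
      rw [e]
      exact Kernel.measurable _⟩

instance (p : ℕ) : IsMarkovKernel (pairKernel M b p) := ⟨fun q => by
  change IsProbabilityMeasure (pairKer M b p q)
  unfold pairKer
  split_ifs
  · exact Measure.isProbabilityMeasure_map (by fun_prop)
  · infer_instance⟩

instance : IsProbabilityMeasure (pairInit M0 b) := by
  unfold pairInit
  split_ifs
  · exact Measure.isProbabilityMeasure_map (by fun_prop)
  · infer_instance

lemma muB_succ (hG : IsPotential G (k + 1)) {f : X × X → ℝ} (hf : BddMeas f) :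
    muB M0 M G (k + 1) b f
      = muB M0 M G k b fun q => G k q.1 * G k q.2 * ∫ y, f y ∂(pairKer M b (k + 1) q) := by
  have hprod : BddMeas fun ω : ℕ → X × X =>
      ∏ p ∈ Finset.range (k + 1), G p (ω p).1 * G p (ω p).2 :=
    BddMeas.prod _ fun p hp => by
      have h := (hG p (Finset.mem_range.mp hp)).1
      exact (h.comp (measurable_fst.comp (measurable_pi_apply p))).mul
        (h.comp (measurable_snd.comp (measurable_pi_apply p)))
  refine (integral_markovPath_succ (κ := pairKernel M b) k
    ((hf.comp (measurable_pi_apply (k + 1))).mul hprod)).trans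
    (integral_congr_ae (.of_forall fun ω => ?_))
  have e : ∀ y, ∏ p ∈ Finset.range (k + 1), G p (Function.update ω (k + 1) y p).1 *
      G p (Function.update ω (k + 1) y p).2
      = ∏ p ∈ Finset.range (k + 1), G p (ω p).1 * G p (ω p).2 := fun y =>
    Finset.prod_congr rfl fun p hp => by
      rw [Function.update_of_ne (Finset.mem_range.mp hp).ne]
  simp only [e, Function.update_self, integral_mul_const, Finset.prod_range_succ]
  change (∫ y, f y ∂(pairKer M b (k + 1) (ω k))) * _ = _
  ring

/-- The function `(x, x') ↦ g x * h x'`. -/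
def tens₂ (g h : X → ℝ) : X × X → ℝ := fun q => g q.1 * h q.2

lemma BddMeas.tens₂ {g h : X → ℝ} (hg : BddMeas g) (hh : BddMeas h) : BddMeas (tens₂ g h) :=
  (hg.comp measurable_fst).mul (hh.comp measurable_snd)

lemma muB_succ_of_false (hG : IsPotential G (k + 1)) (hb : b (k + 1) = false) {g h : X → ℝ}
    (hg : BddMeas g) (hh : BddMeas h) :
    muB M0 M G (k + 1) b (tens₂ g h)
      = muB M0 M G k b (tens₂ (qOp M G k g) (qOp M G k h)) := by
  rw [muB_succ hG (hg.tens₂ hh)]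
  congr 1
  ext q
  simp only [pairKer, hb, tens₂, qOp]
  rw [if_neg (by simp), integral_prod_mul]
  ring

lemma muB_succ_of_true (hG : IsPotential G (k + 1)) (hb : b (k + 1) = true) {g h : X → ℝ}
    (hg : BddMeas g) (hh : BddMeas h) :
    muB M0 M G (k + 1) b (tens₂ g h)
      = muB M0 M G k b (tens₂ (qOp M G k fun x => g x * h x) (G k)) := by
  rw [muB_succ hG (hg.tens₂ hh)]
  congr 1
  ext q
  simp only [pairKer, hb, if_true]
  rw [integral_map (by fun_prop) (hg.tens₂ hh).1.aestronglyMeasurable]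
  simp only [tens₂, qOp]
  ring

lemma muB_of_forall_false (hG : IsPotential G k) (hb : ∀ p ≤ k, b p = false) {g h : X → ℝ}
    (hg : BddMeas g) (hh : BddMeas h) :
    muB M0 M G k b (tens₂ g h) = gInt M0 M G k g * gInt M0 M G k h := by
  induction k generalizing g h with
  | zero =>
    rw [muB_zero _ _ _ _ (hg.tens₂ hh).1, pairInit, if_neg (by simp [hb 0 le_rfl])]
    exact integral_prod_mul g h
  | succ k ih =>
    have hGk := (hG k k.lt_succ_self).1
    rw [muB_succ_of_false hG (hb _ le_rfl) hg hh, ih (hG.mono k.le_succ)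
      (fun p hp => hb p (hp.trans k.le_succ)) (hGk.qOp hg) (hGk.qOp hh), gInt_succ hG hg,
      gInt_succ hG hh]

/-- The asymptotic variance `∑ p ≤ k, c_p⁻¹ (μ_{e_p}(f ⊗ f) - μ_{0_k}(f ⊗ f))` of `γ_k^N(f)`. -/
def asympVar (M0 : Measure X) (M : ℕ → Kernel X X) (G : ℕ → X → ℝ) (c : ℕ → ℝ) (k : ℕ)
    (f : X → ℝ) : ℝ :=
  ∑ p ∈ Finset.range (k + 1),
    (c p)⁻¹ * (muB M0 M G k (eVec p) (tens f) - muB M0 M G k zeroVec (tens f))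

lemma asympVar_zero (c : ℕ → ℝ) {f : X → ℝ} (hf : BddMeas f) :
    asympVar M0 M G c 0 f = (c 0)⁻¹ * (∫ x, f x ^ 2 ∂M0 - (∫ x, f x ∂M0) ^ 2) := by
  have hG : IsPotential G 0 := fun p hp => absurd hp p.not_lt_zero
  have h0 : muB M0 M G 0 zeroVec (tens f) = gInt M0 M G 0 f * gInt M0 M G 0 f :=
    muB_of_forall_false hG (fun _ _ => rfl) hf hf
  have h1 : muB M0 M G 0 (eVec 0) (tens f) = ∫ x, f x ^ 2 ∂M0 := by
    rw [muB_zero _ _ _ _ (f := tens f) (hf.tens₂ hf).1, pairInit, if_pos (by simp [eVec]),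
      integral_map (f := tens f) (by fun_prop) (hf.tens₂ hf).1.aestronglyMeasurable]
    simp [tens, sq]
  simp only [asympVar, zero_add, Finset.range_one, Finset.sum_singleton, h0, h1]
  simp [gInt, gammaFK, sq]

lemma asympVar_succ (hG : IsPotential G (k + 1)) (c : ℕ → ℝ) {f : X → ℝ} (hf : BddMeas f) :
    asympVar M0 M G c (k + 1) f = asympVar M0 M G c k (qOp M G k f)
      + (c (k + 1))⁻¹ * (gInt M0 M G k (G k) * gInt M0 M G k (qOp M G k fun x => f x ^ 2)
        - gInt M0 M G k (qOp M G k f) ^ 2) := by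
  have hG' := hG.mono k.le_succ
  have hGk := (hG k k.lt_succ_self).1
  have hz : muB M0 M G (k + 1) zeroVec (tens f) = muB M0 M G k zeroVec (tens (qOp M G k f)) :=
    muB_succ_of_false hG rfl hf hf
  rw [asympVar, Finset.sum_range_succ, asympVar]
  congr 1
  · refine Finset.sum_congr rfl fun p hp => ?_
    rw [hz]
    congr 2
    exact muB_succ_of_false hG (by simpa [eVec] using (Finset.mem_range.mp hp).ne') hf hf
  · have h1 : muB M0 M G (k + 1) (eVec (k + 1)) (tens f)
        = muB M0 M G k (eVec (k + 1)) (tens₂ (qOp M G k fun x => f x * f x) (G k)) :=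
      muB_succ_of_true hG (by simp [eVec]) hf hf
    have h0 : muB M0 M G k zeroVec (tens (qOp M G k f))
        = gInt M0 M G k (qOp M G k f) * gInt M0 M G k (qOp M G k f) :=
      muB_of_forall_false hG' (fun _ _ => rfl) (hGk.qOp hf) (hGk.qOp hf)
    rw [hz, h0, h1, muB_of_forall_false hG'
      (fun p hp => by simpa [eVec] using (Nat.lt_succ_of_le hp).ne)
      (hGk.qOp (hf.mul hf)) hGk]
    simp only [sq]
    ring

end PairChain

section ParticleNumbers

variable {c : ℕ → ℝ} {p : ℕ}

lemma npart_pos (hc : 0 < c p) {N : ℕ} (hN : 1 ≤ N) : 0 < npart c N p :=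
  Nat.ceil_pos.mpr (mul_pos hc (by exact_mod_cast hN))

lemma tendsto_mul_inv_npart (hc : 0 < c p) :
    Tendsto (fun N : ℕ => (N : ℝ) * (npart c N p : ℝ)⁻¹) atTop (nhds (c p)⁻¹) := by
  have h := ((tendsto_nat_ceil_mul_div_atTop hc.le).comp tendsto_natCast_atTop_atTop).inv₀ hc.ne'
  refine h.congr fun N => ?_
  simp [npart, div_eq_mul_inv]

lemma inv_npart_sq_le (hc : 0 < c p) {N : ℕ} (hN : 1 ≤ N) :
    ((npart c N p : ℝ) ^ 2)⁻¹ ≤ (c p ^ 2)⁻¹ * ((N : ℝ) ^ 2)⁻¹ := by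
  have h : 0 < c p * N := mul_pos hc (by exact_mod_cast hN)
  rw [← mul_inv, ← mul_pow]
  exact inv_anti₀ (by positivity) (pow_le_pow_left₀ h.le (Nat.le_ceil _) 2)

end ParticleNumbers

section Limits

variable [Nonempty X] {M0 : Measure X} [IsProbabilityMeasure M0]
  {M : ℕ → Kernel X X} [∀ p, IsMarkovKernel (M p)]
  {G : ℕ → X → ℝ} {c : ℕ → ℝ} {k : ℕ}

lemma exists_integral_gammaN_npart_sub_pow_four_le (hG : IsPotential G k)
    (hc : ∀ p ≤ k, 0 < c p) {f : X → ℝ} (hf : BddMeas f) :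
    ∃ C, ∀ N : ℕ, 1 ≤ N →
      ∫ ω, (gammaN G (npart c N) k f ω - gInt M0 M G k f) ^ 4 ∂(pfLaw M0 M G (npart c N) k)
        ≤ C * ((N : ℝ) ^ 2)⁻¹ := by
  obtain ⟨C, hC0, hC⟩ := exists_integral_gammaN_sub_pow_four_le (M0 := M0) (M := M) hG hf
  refine ⟨C * ∑ p ∈ Finset.range (k + 1), (c p ^ 2)⁻¹, fun N hN => ?_⟩
  refine (hC (npart c N) fun p hp => npart_pos (hc p hp) hN).trans ?_
  rw [mul_assoc, Finset.sum_mul]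
  exact mul_le_mul_of_nonneg_left (Finset.sum_le_sum fun p hp =>
    inv_npart_sq_le (hc p (Nat.lt_succ_iff.mp (Finset.mem_range.mp hp))) hN) hC0

lemma tendsto_of_tendsto_natCast_mul {u : ℕ → ℝ} {l : ℝ}
    (h : Tendsto (fun N : ℕ => (N : ℝ) * u N) atTop (nhds l)) : Tendsto u atTop (nhds 0) := by
  have h' := tendsto_inv_atTop_nhds_zero_nat (𝕜 := ℝ) |>.mul h
  rw [zero_mul] at h'
  refine h'.congr' ((eventually_ge_atTop 1).mono fun N hN => ?_)
  have : (N : ℝ) ≠ 0 := by positivity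
  field_simp

lemma tendsto_integral_gammaN_mul (hG : IsPotential G k) (hc : ∀ p ≤ k, 0 < c p)
    (h0 : ∀ f : X → ℝ, BddMeas f → Tendsto (fun N : ℕ =>
      ∫ ω, (gammaN G (npart c N) k f ω - gInt M0 M G k f) ^ 2 ∂(pfLaw M0 M G (npart c N) k))
      atTop (nhds 0)) {f g : X → ℝ} (hf : BddMeas f) (hg : BddMeas g) :
    Tendsto (fun N : ℕ => ∫ ω, gammaN G (npart c N) k f ω * gammaN G (npart c N) k g ω
      ∂(pfLaw M0 M G (npart c N) k)) atTop (nhds (gInt M0 M G k f * gInt M0 M G k g)) := by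
  rw [tendsto_iff_dist_tendsto_zero]
  refine squeeze_zero' (.of_forall fun _ => dist_nonneg)
    ((eventually_ge_atTop 1).mono fun N hN => ?_) (by simpa using (h0 f hf).add (h0 g hg))
  have hNp : ∀ p ≤ k, 0 < npart c N p := fun p hp => npart_pos (hc p hp) hN
  have := isProbabilityMeasure_pfLaw (M0 := M0) (M := M) hG fun p hp => hNp p hp.le
  set μ := pfLaw M0 M G (npart c N) k with hμ
  set a := gInt M0 M G k f with ha
  set b := gInt M0 M G k g with hb
  have bf := bddMeas_gammaN hG hf (npart c N)
  have bg := bddMeas_gammaN hG hg (npart c N)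
  have bfa := bf.sub (.const a)
  have bgb := bg.sub (.const b)
  have e : ∫ ω, gammaN G (npart c N) k f ω * gammaN G (npart c N) k g ω ∂μ - a * b
      = ∫ ω, (gammaN G (npart c N) k f ω - a) * (gammaN G (npart c N) k g ω - b) ∂μ := by
    have e' : ∀ ω, (gammaN G (npart c N) k f ω - a) * (gammaN G (npart c N) k g ω - b)
        = (gammaN G (npart c N) k f ω * gammaN G (npart c N) k g ω
          - b * gammaN G (npart c N) k f ω) - (a * gammaN G (npart c N) k g ω - a * b) :=
      fun ω => by ring
    simp only [e']
    have i1 : Integrable (fun ω => gammaN G (npart c N) k f ω * gammaN G (npart c N) k g ω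
          - b * gammaN G (npart c N) k f ω) μ :=
      ((bf.mul bg).integrable μ).sub ((bf.integrable μ).const_mul b)
    have i2 : Integrable (fun ω => a * gammaN G (npart c N) k g ω - a * b) μ :=
      ((bg.integrable μ).const_mul a).sub (integrable_const _)
    rw [integral_sub i1 i2, integral_sub ((bf.mul bg).integrable μ)
      ((bf.integrable μ).const_mul b), integral_sub ((bg.integrable μ).const_mul a)
      (integrable_const _), integral_const_mul, integral_const_mul, hμ,
      integral_gammaN hG hNp hf, integral_gammaN hG hNp hg, ← ha, ← hb]
    simp
    ring
  rw [Real.dist_eq, e, ← integral_add ((bfa.pow 2).integrable μ) ((bgb.pow 2).integrable μ)]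
  refine abs_integral_le_integral_abs.trans (integral_mono ((bfa.mul bgb).integrable μ).abs
    (((bfa.pow 2).integrable μ).add ((bgb.pow 2).integrable μ)) fun ω => ?_)
  simp only [abs_mul]
  have h := two_mul_le_add_sq |gammaN G (npart c N) k f ω - a| |gammaN G (npart c N) k g ω - b|
  have := mul_nonneg (abs_nonneg (gammaN G (npart c N) k f ω - a))
    (abs_nonneg (gammaN G (npart c N) k g ω - b))
  simp only [sq_abs] at h
  linarith

/-- The rescaled mean square error of `γ_k^N(f)` converges to its asymptotic variance. -/
lemma tendsto_mul_integral_gammaN_sub_sq (hG : IsPotential G k) (hc : ∀ p ≤ k, 0 < c p)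
    {f : X → ℝ} (hf : BddMeas f) :
    Tendsto (fun N : ℕ => (N : ℝ) *
      ∫ ω, (gammaN G (npart c N) k f ω - gInt M0 M G k f) ^ 2 ∂(pfLaw M0 M G (npart c N) k))
      atTop (nhds (asympVar M0 M G c k f)) := by
  induction k generalizing f with
  | zero =>
    rw [asympVar_zero c hf]
    refine ((tendsto_mul_inv_npart (hc 0 le_rfl)).mul_const _).congr'
      ((eventually_ge_atTop 1).mono fun N hN => ?_)
    beta_reduce
    rw [integral_gammaN_sub_sq_zero (npart_pos (hc 0 le_rfl) hN) hf, gInt, gammaFK]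
    ring
  | succ k ih =>
    have hG' := hG.mono k.le_succ
    have hc' : ∀ p ≤ k, 0 < c p := fun p hp => hc p (hp.trans k.le_succ)
    have hGk := (hG k k.lt_succ_self).1
    have h0 := fun (f : X → ℝ) (hf : BddMeas f) => tendsto_of_tendsto_natCast_mul (ih hG' hc' hf)
    have hQf := hGk.qOp (M := M) hf
    have h1 := tendsto_integral_gammaN_mul hG' hc' h0 hGk (hGk.qOp (M := M) (hf.pow 2))
    have h2 := tendsto_integral_gammaN_mul hG' hc' h0 hQf hQf
    simp only [← sq] at h2
    rw [asympVar_succ hG c hf]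
    refine ((ih hG' hc' hQf).add ((tendsto_mul_inv_npart (hc (k + 1) le_rfl)).mul
      (h1.sub h2))).congr' ((eventually_ge_atTop 1).mono fun N hN => ?_)
    beta_reduce
    rw [integral_gammaN_sub_sq_succ (Np := npart c N) hG (fun p hp => npart_pos (hc p hp) hN) hf,
      gInt_succ hG hf]
    ring

end Limits

/-- Borel–Cantelli in the form used for the particle system: fourth moments of order `N⁻²` force
almost sure convergence to zero, whatever the coupling between different `N`. -/
lemma ae_tendsto_zero_of_integral_pow_four_le {Ω : Type*} [MeasurableSpace Ω]
    (P : Measure (ℕ → Ω)) [IsProbabilityMeasure P] {μ : ℕ → Measure Ω}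
    (hμ : ∀ N, P.map (fun ω => ω N) = μ N) {F : ℕ → Ω → ℝ} (hF : ∀ N, BddMeas (F N)) {C : ℝ}
    (hC : ∀ N : ℕ, 1 ≤ N → ∫ ω, F N ω ^ 4 ∂(μ N) ≤ C * ((N : ℝ) ^ 2)⁻¹) :
    ∀ᵐ ω ∂P, Tendsto (fun N => F N (ω N)) atTop (nhds 0) := by
  have hb : ∀ N, BddMeas fun ω : ℕ → Ω => F N (ω N) ^ 4 :=
    fun N => ((hF N).pow 4).comp (measurable_pi_apply N)
  have hm : ∀ N, Measurable fun ω : ℕ → Ω => ENNReal.ofReal (F N (ω N) ^ 4) :=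
    fun N => (hb N).1.ennreal_ofReal
  have hle : ∀ N : ℕ, ∫⁻ ω, ENNReal.ofReal (F (N + 1) (ω (N + 1)) ^ 4) ∂P
      ≤ ENNReal.ofReal (C * (((N + 1 : ℕ) : ℝ) ^ 2)⁻¹) := fun N => by
    rw [← ofReal_integral_eq_lintegral_ofReal ((hb (N + 1)).integrable P)
      (.of_forall fun ω => by positivity)]
    refine ENNReal.ofReal_le_ofReal (le_trans (le_of_eq ?_) (hC (N + 1) (by omega)))
    rw [← hμ, integral_map (measurable_pi_apply _).aemeasurable
      ((hF (N + 1)).pow 4).1.aestronglyMeasurable]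
  have hsum : Summable fun N : ℕ => C * (((N + 1 : ℕ) : ℝ) ^ 2)⁻¹ :=
    ((summable_nat_add_iff 1).mpr (Real.summable_nat_pow_inv.mpr one_lt_two)).mul_left C
  have hfin : ∫⁻ ω, ∑' N : ℕ, ENNReal.ofReal (F (N + 1) (ω (N + 1)) ^ 4) ∂P ≠ ∞ := by
    rw [lintegral_tsum fun N => (hm (N + 1)).aemeasurable]
    exact ne_top_of_le_ne_top hsum.tsum_ofReal_ne_top (ENNReal.tsum_le_tsum hle)
  filter_upwards [ae_lt_top (Measurable.tsum fun N => hm (N + 1)) hfin] with ω hω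
  rw [← tendsto_add_atTop_iff_nat 1]
  have h := (ENNReal.tendsto_toReal ENNReal.zero_ne_top).comp
    (ENNReal.tendsto_atTop_zero_of_tsum_ne_top hω.ne)
  have h4 : Tendsto (fun N => F (N + 1) (ω (N + 1)) ^ 4) atTop (nhds 0) := by
    refine h.congr fun N => ?_
    simp only [Function.comp_apply]
    exact ENNReal.toReal_ofReal (by positivity)
  have h1 := h4.sqrt.sqrt
  simp only [Real.sqrt_zero] at h1
  refine (tendsto_zero_iff_abs_tendsto_zero _).mpr (h1.congr fun N => ?_)
  rw [show F (N + 1) (ω (N + 1)) ^ 4 = (F (N + 1) (ω (N + 1)) ^ 2) ^ 2 by ring,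
    Real.sqrt_sq (sq_nonneg _), Real.sqrt_sq_eq_abs]
  rfl

lemma BddMeas.hatf {G : ℕ → X → ℝ} {k : ℕ} (hGk : BddMeas (G k)) {φ : X → ℝ} (hφ : BddMeas φ) :
    BddMeas (hatf G k φ) :=
  hGk.mul hφ

section Updated

variable {Y : Type*} {G : ℕ → Y → ℝ} {k : ℕ}

lemma hatf_one : hatf G k 1 = G k := by
  ext x
  simp [hatf]

lemma gammaHatN_sub_const (Np : ℕ → ℕ) (φ : Y → ℝ) (e : ℝ) (ω : (ℕ → ℕ → Y) × (ℕ → ℕ → ℕ)) :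
    gammaHatN G Np k (fun x => φ x - e) ω = gammaHatN G Np k φ ω - e * gammaHatN G Np k 1 ω := by
  simp only [gammaHatN, gammaN, etaN, hatf, mul_sub, Finset.sum_sub_distrib, Pi.one_apply, mul_one,
    ← Finset.sum_mul]
  ring

lemma gammaHatN_one_pos {Np : ℕ → ℕ} (hpos : ∀ p ≤ k, ∀ x, 0 < G p x) (hN : ∀ p ≤ k, 0 < Np p)
    (ω : (ℕ → ℕ → Y) × (ℕ → ℕ → ℕ)) : 0 < gammaHatN G Np k 1 ω := by
  have h : ∀ p ≤ k, 0 < etaN Np p (G p) ω := fun p hp =>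
    mul_pos (inv_pos.mpr (by exact_mod_cast hN p hp)) (Finset.sum_pos (fun i _ => hpos p hp _)
      (Finset.nonempty_range_iff.mpr (hN p hp).ne'))
  rw [gammaHatN, hatf_one]
  exact mul_pos (Finset.prod_pos fun p hp => h p (Finset.mem_range.mp hp).le) (h k le_rfl)

lemma abs_etaHatN_le {Np : ℕ → ℕ} (hpos : ∀ p ≤ k, ∀ x, 0 < G p x) (hN : ∀ p ≤ k, 0 < Np p)
    {φ : Y → ℝ} {K : ℝ} (hK : ∀ x, |φ x| ≤ K) (ω : (ℕ → ℕ → Y) × (ℕ → ℕ → ℕ)) :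
    |etaHatN G Np k φ ω| ≤ K := by
  have h1 := gammaHatN_one_pos hpos hN ω
  have hprod : 0 ≤ ∏ p ∈ Finset.range k, etaN Np p (G p) ω := Finset.prod_nonneg fun p hp =>
    mul_nonneg (by positivity) (Finset.sum_nonneg fun i _ =>
      (hpos p (Finset.mem_range.mp hp).le _).le)
  have hsum : |∑ i ∈ Finset.range (Np k), hatf G k φ (ω.1 k i)|
      ≤ K * ∑ i ∈ Finset.range (Np k), G k (ω.1 k i) := by
    rw [Finset.mul_sum]
    refine (Finset.abs_sum_le_sum_abs _ _).trans (Finset.sum_le_sum fun i _ => ?_)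
    rw [hatf, abs_mul, abs_of_pos (hpos k le_rfl _), mul_comm]
    exact mul_le_mul_of_nonneg_right (hK _) (hpos k le_rfl _).le
  rw [etaHatN, abs_div, abs_of_pos h1, div_le_iff₀ h1, gammaHatN, gammaHatN, hatf_one, gammaN,
    gammaN, abs_mul, abs_of_nonneg hprod, mul_left_comm K]
  refine mul_le_mul_of_nonneg_left ?_ hprod
  rw [etaN, etaN, abs_mul, abs_of_nonneg (by positivity : (0 : ℝ) ≤ (Np k : ℝ)⁻¹),
    mul_left_comm K]
  exact mul_le_mul_of_nonneg_left hsum (by positivity)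

end Updated

lemma abs_sq_sub_sq_le {a x u K : ℝ} (h : a = x + a * u) (hK : 1 ≤ K) (ha : |a| ≤ K) :
    |a ^ 2 - x ^ 2| ≤ 6 * K ^ 2 * (|x| ^ 3 + |u| ^ 3) := by
  have e : a ^ 2 - x ^ 2 = 2 * (x ^ 2 * u) + 3 * (a * (x * u ^ 2)) + a ^ 2 * u ^ 3 := by
    have hx : x = a - a * u := by linarith
    rw [hx]
    ring
  have hx := abs_nonneg x
  have hu := abs_nonneg u
  have h1 : |x| ^ 2 * |u| ≤ |x| ^ 3 + |u| ^ 3 := by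
    nlinarith [mul_nonneg (sq_nonneg (|x| - |u|)) (add_nonneg hx hu), mul_nonneg hx (sq_nonneg |u|),
      pow_nonneg hx 3, pow_nonneg hu 3]
  have h2 : |x| * |u| ^ 2 ≤ |x| ^ 3 + |u| ^ 3 := by
    nlinarith [mul_nonneg (sq_nonneg (|x| - |u|)) (add_nonneg hx hu), mul_nonneg hu (sq_nonneg |x|),
      pow_nonneg hx 3, pow_nonneg hu 3]
  have h3 : |u| ^ 3 ≤ |x| ^ 3 + |u| ^ 3 := le_add_of_nonneg_left (by positivity)
  have hK1 : 1 ≤ K ^ 2 := one_le_pow₀ hK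
  have hK2 : |a| ≤ K ^ 2 := ha.trans (by nlinarith)
  have hK3 : |a| ^ 2 ≤ K ^ 2 := pow_le_pow_left₀ (abs_nonneg a) ha 2
  have t1 : |x| ^ 2 * |u| ≤ K ^ 2 * (|x| ^ 3 + |u| ^ 3) :=
    h1.trans (le_mul_of_one_le_left (by positivity) hK1)
  have t2 : |a| * (|x| * |u| ^ 2) ≤ K ^ 2 * (|x| ^ 3 + |u| ^ 3) :=
    mul_le_mul hK2 h2 (by positivity) (by positivity)
  have t3 : |a| ^ 2 * |u| ^ 3 ≤ K ^ 2 * (|x| ^ 3 + |u| ^ 3) :=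
    mul_le_mul hK3 h3 (by positivity) (by positivity)
  rw [e]
  refine (abs_add_three _ _ _).trans ?_
  simp only [abs_mul, abs_pow, Nat.abs_ofNat]
  linarith

section Limits

variable [Nonempty X] {M0 : Measure X} [IsProbabilityMeasure M0]
  {M : ℕ → Kernel X X} [∀ p, IsMarkovKernel (M p)]
  {G : ℕ → X → ℝ} {c : ℕ → ℝ} {k : ℕ}

lemma ae_tendsto_gammaN (hG : IsPotential G k) (hc : ∀ p ≤ k, 0 < c p) {f : X → ℝ}
    (hf : BddMeas f) (P : Measure (ℕ → (ℕ → ℕ → X) × (ℕ → ℕ → ℕ))) [IsProbabilityMeasure P]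
    (hP : ∀ N : ℕ, P.map (fun ω => ω N) = pfLaw M0 M G (npart c N) k) :
    ∀ᵐ ω ∂P, Tendsto (fun N => gammaN G (npart c N) k f (ω N)) atTop
      (nhds (gInt M0 M G k f)) := by
  obtain ⟨C, hC⟩ := exists_integral_gammaN_npart_sub_pow_four_le (M0 := M0) (M := M) hG hc hf
  filter_upwards [ae_tendsto_zero_of_integral_pow_four_le P hP
    (fun N => (bddMeas_gammaN hG hf (npart c N)).sub (.const (gInt M0 M G k f))) hC] with ω hω
  simpa using hω.add_const (gInt M0 M G k f)

lemma tendsto_mul_integral_abs_gammaN_sub_pow_three (hG : IsPotential G k)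
    (hc : ∀ p ≤ k, 0 < c p) {f : X → ℝ} (hf : BddMeas f) :
    Tendsto (fun N : ℕ => (N : ℝ) * ∫ ω, |gammaN G (npart c N) k f ω - gInt M0 M G k f| ^ 3
      ∂(pfLaw M0 M G (npart c N) k)) atTop (nhds 0) := by
  obtain ⟨C, hC⟩ := exists_integral_gammaN_npart_sub_pow_four_le (M0 := M0) (M := M) hG hc hf
  have h2 := tendsto_mul_integral_gammaN_sub_sq (M0 := M0) (M := M) hG hc hf
  have hs : Tendsto (fun N : ℕ => (√(N : ℝ))⁻¹) atTop (nhds 0) :=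
    tendsto_inv_atTop_zero.comp (Real.tendsto_sqrt_atTop.comp tendsto_natCast_atTop_atTop)
  have hlim := hs.mul (h2.add_const C)
  rw [zero_mul] at hlim
  refine squeeze_zero' (.of_forall fun N => mul_nonneg N.cast_nonneg
    (integral_nonneg fun ω => by positivity)) ((eventually_ge_atTop 1).mono fun N hN => ?_) hlim
  have hNp : ∀ p < k, 0 < npart c N p := fun p hp => npart_pos (hc p hp.le) hN
  have := isProbabilityMeasure_pfLaw (M0 := M0) (M := M) hG hNp
  have hC := hC N hN
  set μ := pfLaw M0 M G (npart c N) k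
  have hb := (bddMeas_gammaN hG hf (npart c N)).sub (.const (gInt M0 M G k f))
  have hN0 : (0 : ℝ) < N := by exact_mod_cast hN
  have hs0 : 0 < √(N : ℝ) := Real.sqrt_pos.mpr hN0
  have hss : √(N : ℝ) ^ 2 = N := Real.sq_sqrt hN0.le
  set s := √(N : ℝ)
  have hpt : ∀ t : ℝ, |t| ^ 3 ≤ s⁻¹ * t ^ 2 + s * t ^ 4 := fun t => by
    have h4 : t ^ 4 = |t| ^ 4 := (Even.pow_abs (by decide) t).symm
    rw [← sq_abs t, h4]
    have e : s⁻¹ * |t| ^ 2 + s * |t| ^ 4 - |t| ^ 3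
        = s⁻¹ * |t| ^ 2 * (1 + (s * |t|) ^ 2 - s * |t|) := by
      field_simp
    have : 0 ≤ s⁻¹ * |t| ^ 2 * (1 + (s * |t|) ^ 2 - s * |t|) :=
      mul_nonneg (by positivity) (by nlinarith [sq_nonneg (s * |t| - 1)])
    linarith
  have i2 := ((hb.pow 2).integrable μ).const_mul s⁻¹
  have i4 := ((hb.pow 4).integrable μ).const_mul s
  have hle : ∫ ω, |gammaN G (npart c N) k f ω - gInt M0 M G k f| ^ 3 ∂μ
      ≤ s⁻¹ * ∫ ω, (gammaN G (npart c N) k f ω - gInt M0 M G k f) ^ 2 ∂μ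
        + s * ∫ ω, (gammaN G (npart c N) k f ω - gInt M0 M G k f) ^ 4 ∂μ := by
    rw [← integral_const_mul, ← integral_const_mul, ← integral_add i2 i4]
    exact integral_mono_of_nonneg (.of_forall fun ω => by positivity) (i2.add i4)
      (.of_forall fun ω => hpt _)
  calc (N : ℝ) * ∫ ω, |gammaN G (npart c N) k f ω - gInt M0 M G k f| ^ 3 ∂μ
      ≤ N * (s⁻¹ * ∫ ω, (gammaN G (npart c N) k f ω - gInt M0 M G k f) ^ 2 ∂μ
        + s * (C * ((N : ℝ) ^ 2)⁻¹)) := by gcongr; exact hle.trans (by gcongr)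
    _ = _ := by
      rw [← hss]
      field_simp

lemma gInt_one_mul_eInt (hG : IsPotential G k) :
    gInt M0 M G k 1 * eInt M0 M G k (G k) = gHatInt M0 M G k 1 := by
  have h1 : 0 < gInt M0 M G k 1 := gInt_pos hG (.const 1) fun _ => one_pos
  rw [eInt, gHatInt, hatf_one]
  field_simp

lemma sigma2Hat_eq (hG : IsPotential G k) (φ : X → ℝ) :
    sigma2Hat M0 M G c k φ = asympVar M0 M G c k (hatf G k φ) / gHatInt M0 M G k 1 ^ 2 := by
  rw [sigma2Hat, asympVar, Finset.sum_div]
  refine Finset.sum_congr rfl fun p _ => ?_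
  rw [vpnHat, vpn, ← gInt_one_mul_eInt hG, mul_pow, div_div, mul_div_assoc]

end Limits

section UpdatedLimits

variable [Nonempty X] {M0 : Measure X} [IsProbabilityMeasure M0]
  {M : ℕ → Kernel X X} [∀ p, IsMarkovKernel (M p)]
  {G : ℕ → X → ℝ} {c : ℕ → ℝ} {n : ℕ}

lemma gHatInt_one_pos (hG : IsPotential G (n + 1)) : 0 < gHatInt M0 M G n 1 := by
  obtain ⟨hGn, hpos⟩ := hG n n.lt_succ_self
  rw [gHatInt, hatf_one]
  exact gInt_pos (hG.mono n.le_succ) hGn hpos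

lemma gHatInt_sub_eHatInt (hG : IsPotential G (n + 1)) {φ : X → ℝ} (hφ : BddMeas φ) :
    gHatInt M0 M G n (fun x => φ x - eHatInt M0 M G n φ) = 0 := by
  have hg := gHatInt_one_pos (M0 := M0) (M := M) hG
  have hGn := (hG n n.lt_succ_self).1
  have := isFiniteMeasure_gammaFK (M0 := M0) (M := M) (hG.mono n.le_succ)
  have e : gHatInt M0 M G n (fun x => φ x - eHatInt M0 M G n φ)
      = gHatInt M0 M G n φ - eHatInt M0 M G n φ * gHatInt M0 M G n 1 := by
    simp only [gHatInt, gInt]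
    rw [← integral_const_mul, ← integral_sub ((hGn.hatf hφ).integrable _)
      ((hatf_one (G := G) ▸ hGn.integrable _ : Integrable (hatf G n 1) _).const_mul _)]
    refine integral_congr_ae (.of_forall fun x => ?_)
    simp only [hatf, Pi.one_apply, eHatInt]
    ring
  rw [e, eHatInt, div_mul_cancel₀ _ hg.ne', sub_self]

lemma tendsto_mul_variance_gammaHatN (hG : IsPotential G (n + 1)) (hc : ∀ p ≤ n, 0 < c p)
    {φ : X → ℝ} (hφ : BddMeas φ) :
    Tendsto (fun N : ℕ => (N : ℝ) *
        variance (fun ω => gammaHatN G (npart c N) n φ ω / gHatInt M0 M G n 1)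
          (pfLaw M0 M G (npart c N) n)) atTop (nhds (sigma2Hat M0 M G c n φ)) := by
  have hG' := hG.mono n.le_succ
  have hf := (hG n n.lt_succ_self).1.hatf hφ
  rw [sigma2Hat_eq hG']
  refine ((tendsto_mul_integral_gammaN_sub_sq hG' hc hf).div_const _).congr'
    ((eventually_ge_atTop 1).mono fun N hN => ?_)
  have hNp : ∀ p ≤ n, 0 < npart c N p := fun p hp => npart_pos (hc p hp) hN
  simp only [gammaHatN]
  rw [variance_eq_integral ((measurable_gammaN hG' hf.1 _).div_const _).aemeasurable]
  rw [integral_div, integral_gammaN hG' hNp hf]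
  simp only [← sub_div, div_pow, integral_div, mul_div_assoc]

/-- The normalized and unnormalized updated particle approximations of a centred function have
the same asymptotic mean square. -/
lemma tendsto_mul_integral_etaHatN_sq (hG : IsPotential G (n + 1)) (hc : ∀ p ≤ n, 0 < c p)
    {φ : X → ℝ} (hφ : BddMeas φ) (h0 : gHatInt M0 M G n φ = 0) :
    Tendsto (fun N : ℕ => (N : ℝ) *
        ∫ ω, etaHatN G (npart c N) n φ ω ^ 2 ∂(pfLaw M0 M G (npart c N) n)) atTop
      (nhds (sigma2Hat M0 M G c n φ)) := by
  have hG' := hG.mono n.le_succ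
  have hGn := (hG n n.lt_succ_self).1
  have hpos : ∀ p ≤ n, ∀ x, 0 < G p x := fun p hp => (hG p (Nat.lt_succ_of_le hp)).2
  have hf := hGn.hatf hφ
  have hf1 : BddMeas (hatf G n 1) := by rwa [hatf_one]
  obtain ⟨K', hK'⟩ := hφ.2
  set K := max K' 1 with hK
  have hK1 : 1 ≤ K := le_max_right _ _
  have hφK : ∀ x, |φ x| ≤ K := fun x => (hK' x).trans (le_max_left _ _)
  have hg := gHatInt_one_pos (M0 := M0) (M := M) hG
  have hlim := tendsto_mul_integral_gammaN_sub_sq (M0 := M0) (M := M) hG' hc hf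
  have hx3 := tendsto_mul_integral_abs_gammaN_sub_pow_three (M0 := M0) (M := M) hG' hc hf
  have hu3 := tendsto_mul_integral_abs_gammaN_sub_pow_three (M0 := M0) (M := M) hG' hc hf1
  change gInt M0 M G n (hatf G n φ) = 0 at h0
  rw [h0] at hlim hx3
  rw [sigma2Hat_eq hG']
  set g := gHatInt M0 M G n 1 with hgdef
  change Tendsto (fun N : ℕ => (N : ℝ) * ∫ ω, |gammaN G (npart c N) n (hatf G n 1) ω - g| ^ 3
      ∂(pfLaw M0 M G (npart c N) n)) atTop (nhds 0) at hu3
  have hR : Tendsto (fun N : ℕ => 6 * K ^ 2 * (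
      (N * ∫ ω, |gammaN G (npart c N) n (hatf G n φ) ω - 0| ^ 3 ∂(pfLaw M0 M G (npart c N) n))
      + N * ∫ ω, |gammaN G (npart c N) n (hatf G n 1) ω - g| ^ 3 ∂(pfLaw M0 M G (npart c N) n))
      / g ^ 3) atTop (nhds 0) := by
    simpa using ((hx3.add hu3).const_mul (6 * K ^ 2)).div_const (g ^ 3)
  refine tendsto_of_tendsto_of_dist (hlim.div_const (g ^ 2))
    (squeeze_zero' (.of_forall fun _ => dist_nonneg)
      ((eventually_ge_atTop 1).mono fun N hN => ?_) hR)
  have hNp : ∀ p ≤ n, 0 < npart c N p := fun p hp => npart_pos (hc p hp) hN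
  have := isProbabilityMeasure_pfLaw (M0 := M0) (M := M) hG' fun p hp => hNp p hp.le
  set μ := pfLaw M0 M G (npart c N) n
  have bx := bddMeas_gammaN hG' hf (npart c N)
  have bu := bddMeas_gammaN hG' hf1 (npart c N)
  have ba : BddMeas fun ω => etaHatN G (npart c N) n φ ω :=
    ⟨bx.1.div bu.1, K, abs_etaHatN_le hpos hNp hφK⟩
  have habs : ∀ {F : (ℕ → ℕ → X) × (ℕ → ℕ → ℕ) → ℝ}, BddMeas F → BddMeas fun ω => |F ω| :=
    fun hF => hF.continuous_comp continuous_abs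
  have ix := (((habs (bx.sub (.const 0))).pow 3).integrable μ)
  have iu := (((habs (bu.sub (.const g))).pow 3).integrable μ)
  have isq := ((bx.sub (.const 0)).pow 2).integrable μ
  have ia := (ba.pow 2).integrable μ
  have hpt : ∀ ω, |etaHatN G (npart c N) n φ ω ^ 2
      - (gammaN G (npart c N) n (hatf G n φ) ω - 0) ^ 2 / g ^ 2|
      ≤ 6 * K ^ 2 * (|gammaN G (npart c N) n (hatf G n φ) ω - 0| ^ 3
        + |gammaN G (npart c N) n (hatf G n 1) ω - g| ^ 3) / g ^ 3 := fun ω => by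
    have h1 := gammaHatN_one_pos hpos hNp ω
    have ha := abs_etaHatN_le hpos hNp hφK ω
    have e : etaHatN G (npart c N) n φ ω
        = (gammaN G (npart c N) n (hatf G n φ) ω - 0) / g + etaHatN G (npart c N) n φ ω *
          (-(gammaN G (npart c N) n (hatf G n 1) ω - g) / g) := by
      rw [etaHatN]
      unfold gammaHatN at h1 ⊢
      field_simp
      ring
    have h := abs_sq_sub_sq_le e hK1 ha
    rw [div_pow] at h
    refine h.trans (le_of_eq ?_)
    simp only [abs_div, abs_neg, abs_of_pos hg, div_pow]
    ring
  rw [dist_comm, Real.dist_eq, mul_div_assoc, ← mul_sub, abs_mul, abs_of_nonneg N.cast_nonneg,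
    ← integral_div, ← integral_sub ia (isq.div_const _), ← mul_add, ← integral_add ix iu,
    mul_left_comm, mul_div_assoc, ← integral_const_mul, ← integral_div]
  refine mul_le_mul_of_nonneg_left (abs_integral_le_integral_abs.trans ?_) N.cast_nonneg
  exact integral_mono (ia.sub (isq.div_const _)).abs
    (((ix.add iu).const_mul (6 * K ^ 2)).div_const (g ^ 3)) hpt

end UpdatedLimits

theorem statement16
    {X : Type*} [MeasurableSpace X] [Nonempty X] (hX : ∃ x y : X, x ≠ y) (n : ℕ)
    (M0 : Measure X) [IsProbabilityMeasure M0]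
    (M : ℕ → Kernel X X) [∀ p, IsMarkovKernel (M p)]
    (G : ℕ → X → ℝ) (hGm : ∀ p ≤ n, Measurable (G p))
    (hGpos : ∀ p ≤ n, ∀ x, 0 < G p x) (hGbd : ∀ p ≤ n, ∃ C, ∀ x, G p x ≤ C)
    (c : ℕ → ℝ) (hc : ∀ p ≤ n, 0 < c p)
    (φ : X → ℝ) (hφm : Measurable φ) (hφb : ∃ C, ∀ x, |φ x| ≤ C) :
    ((∀ P : Measure (ℕ → (ℕ → ℕ → X) × (ℕ → ℕ → ℕ)), IsProbabilityMeasure P →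
        (∀ N : ℕ, P.map (fun ω => ω N) = pfLaw M0 M G (npart c N) n) →
        ∀ᵐ ω ∂P, Tendsto (fun N => gammaHatN G (npart c N) n φ (ω N)) atTop
          (nhds (gHatInt M0 M G n φ))) ∧
      Tendsto (fun N : ℕ => (N : ℝ) *
          variance (fun ω => gammaHatN G (npart c N) n φ ω / gHatInt M0 M G n 1)
            (pfLaw M0 M G (npart c N) n)) atTop
        (nhds (∑ p ∈ Finset.range (n + 1), (c p)⁻¹ * vpnHat M0 M G n p φ)) ∧
      (∑ p ∈ Finset.range (n + 1), (c p)⁻¹ * vpnHat M0 M G n p φ)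
        = sigma2Hat M0 M G c n φ) ∧
    ((∀ P : Measure (ℕ → (ℕ → ℕ → X) × (ℕ → ℕ → ℕ)), IsProbabilityMeasure P →
        (∀ N : ℕ, P.map (fun ω => ω N) = pfLaw M0 M G (npart c N) n) →
        ∀ᵐ ω ∂P, Tendsto (fun N => etaHatN G (npart c N) n φ (ω N)) atTop
          (nhds (eHatInt M0 M G n φ))) ∧
      Tendsto (fun N : ℕ => (N : ℝ) *
          ∫ ω, (etaHatN G (npart c N) n φ ω - eHatInt M0 M G n φ) ^ 2
            ∂(pfLaw M0 M G (npart c N) n)) atTop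
        (nhds (sigma2Hat M0 M G c n fun x => φ x - eHatInt M0 M G n φ))) := by
  have hG : IsPotential G (n + 1) := fun p hp => by
    have hp' := Nat.lt_succ_iff.mp hp
    obtain ⟨C, hC⟩ := hGbd p hp'
    exact ⟨⟨hGm p hp', C, fun x => (abs_of_pos (hGpos p hp' x)).trans_le (hC x)⟩, hGpos p hp'⟩
  have hφ : BddMeas φ := ⟨hφm, hφb⟩
  have hGn := (hG n n.lt_succ_self).1
  have hg := gHatInt_one_pos (M0 := M0) (M := M) hG
  have h1 : BddMeas (hatf G n 1) := hGn.hatf (.const 1)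
  refine ⟨⟨fun P _ hP => ae_tendsto_gammaN (hG.mono n.le_succ) hc (hGn.hatf hφ) P hP,
    tendsto_mul_variance_gammaHatN hG hc hφ, rfl⟩, fun P _ hP => ?_, ?_⟩
  · filter_upwards [ae_tendsto_gammaN (hG.mono n.le_succ) hc (hGn.hatf hφ) P hP,
      ae_tendsto_gammaN (hG.mono n.le_succ) hc h1 P hP] with ω hω hω1
    exact hω.div hω1 hg.ne'
  · refine (tendsto_mul_integral_etaHatN_sq hG hc (hφ.sub (.const (eHatInt M0 M G n φ)))
      (gHatInt_sub_eHatInt hG hφ)).congr' ((eventually_ge_atTop 1).mono fun N hN => ?_)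
    have hNp : ∀ p ≤ n, 0 < npart c N p := fun p hp => npart_pos (hc p hp) hN
    congr 2
    ext ω
    have hω := (gammaHatN_one_pos hGpos hNp ω).ne'
    rw [etaHatN, etaHatN, gammaHatN_sub_const, sub_div, mul_div_cancel_right₀ _ hω]
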